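/- Let G be a free group of finite rank r with free generating set S, acting on a standard Borel probability space (X, μ) by μ-preserving Borel automorphisms, and let α be a generating partition with H_μ(α) < ∞. Let M be the set of G-invariant Borel probability measures on X, equipped with the σ-algebra generated by the evaluation maps ν ↦ ν(B) for Borel B ⊆ X, and let τ be a Borel probability measure on M concentrated on the ergodic measures and satisfying μ(B) = ∫ ν(B) dτ(ν) for every Borel B (an ergodic decomposition of μ). Then for τ-almost every ν, the partition α is generating for (X, ν) with H_ν(α) < ∞, so f_G(X, ν) = lim_{n→∞} F_G(X, ν, S, B_n·α) is defined, and f_G(X, μ) = ∫ f_G(X, ν) dτ(ν) − (r − 1)·H(τ), where H(τ) = sup{∑_{P ∈ 𝒫} −τ(P)·log τ(P) : 𝒫 a finite measurable partition of M} and where both sides of the equality take values in [−∞, ∞). -/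

import Mathlib

open MeasureTheory Filter Set
open scoped ENNReal symmDiff Pointwise

namespace FPaper

/-- The free group of rank `r`; its free generating set `S` is `{FreeGroup.of i | i : Fin r}`. -/
abbrev FG (r : ℕ) := FreeGroup (Fin r)

/-- The reduced `S`-word length of a group element. -/
def wlen {r : ℕ} (g : FG r) : ℕ := g.toWord.length

/-- The ball of radius `n` in `FG r` with respect to the word length. -/
def ball (r n : ℕ) : Set (FG r) := {g | wlen g ≤ n}

instance ballFinite (r n : ℕ) : Finite (ball r n) := by
  have h : ball r n ⊆ FreeGroup.mk '' {l : List (Fin r × Bool) | l.length ≤ n} :=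
    fun g hg => ⟨g.toWord, hg, FreeGroup.mk_toWord⟩
  exact (((List.finite_length_le _ n).image _).subset h).to_subtype

/-- An action of a group `G` on a measurable space `X` by Borel automorphisms. -/
structure BorelAction (G : Type*) [Group G] (X : Type*) [MeasurableSpace X] where
  act : G → X → X
  act_one : ∀ x, act 1 x = x
  act_mul : ∀ g h x, act (g * h) x = act g (act h x)
  measurable_act : ∀ g, Measurable (act g)

namespace BorelAction

variable {G X : Type*} [Group G] [mX : MeasurableSpace X]

/-- The action preserves the measure `μ`. -/
def Preserves (T : BorelAction G X) (μ : Measure X) : Prop :=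
  ∀ g : G, MeasurePreserving (T.act g) μ μ

/-- The translated set `g · B`. -/
def smulSet (T : BorelAction G X) (g : G) (B : Set X) : Set X := T.act g⁻¹ ⁻¹' B

/-- The translated partition `g · α`, where a countable measurable partition is recorded
by a (measurable, countably-valued) function whose fibers are the cells. -/
def tr {I : Type*} (T : BorelAction G X) (g : G) (a : X → I) : X → I :=
  fun x => a (T.act g⁻¹ x)

/-- The join `F · α = ⋁_{f ∈ F} f · α` of the translates of a partition over a set `F ⊆ G`. -/
def joinF {I : Type*} (T : BorelAction G X) (F : Set G) (a : X → I) : X → (F → I) :=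
  fun x f => a (T.act (f : G)⁻¹ x)

/-- The σ-algebra generated by the partitions `f · α`, `f ∈ F`. -/
def partSA {I : Type*} (T : BorelAction G X) (F : Set G) (a : X → I) : MeasurableSpace X :=
  ⨆ f ∈ F, MeasurableSpace.comap (T.tr f a) ⊤

/-- The partition `a` is generating: the smallest `G`-invariant σ-algebra containing `a`
(i.e. the one generated by all translates of `a`) contains every measurable set up to
`ν`-null sets. -/
def Generating {I : Type*} (T : BorelAction G X) (a : X → I) (ν : Measure X) : Prop :=
  ∀ B : Set X, MeasurableSet B →
    ∃ B', MeasurableSet[T.partSA Set.univ a] B' ∧ ν (B ∆ B') = 0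


/-- Ergodicity of the action with respect to `ν`. -/
def IsErgodic (T : BorelAction G X) (ν : Measure X) : Prop :=
  ∀ B : Set X, MeasurableSet B → (∀ g : G, ν (T.smulSet g B ∆ B) = 0) → ν B = 0 ∨ ν B = 1

/-- The action is essentially free with respect to `ν`. -/
def EssentiallyFree (T : BorelAction G X) (ν : Measure X) : Prop :=
  ν {x | ∀ g : G, g ≠ 1 → T.act g x ≠ x} = 1

/-- The stabilizer subgroup of a point. -/
def stab (T : BorelAction G X) (y : X) : Subgroup G where
  carrier := {g | T.act g y = y}
  one_mem' := T.act_one y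
  mul_mem' := by
    intro g h hg hh
    simp only [Set.mem_setOf_eq] at *
    rw [T.act_mul, hh, hg]
  inv_mem' := by
    intro g hg
    simp only [Set.mem_setOf_eq] at *
    conv_lhs => rw [← hg]
    rw [← T.act_mul, inv_mul_cancel, T.act_one]

end BorelAction

/-- `m` is a `G`-invariant sub-σ-algebra. -/
def InvariantSA {G X : Type*} [Group G] (m : MeasurableSpace X) [mX : MeasurableSpace X]
    (T : BorelAction G X) : Prop :=
  m ≤ mX ∧ ∀ (g : G) (B : Set X), MeasurableSet[m] B → MeasurableSet[m] (T.act g ⁻¹' B)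

/-- A measure is purely atomic: the set of atoms has full measure. -/
def PurelyAtomic {X : Type*} [MeasurableSpace X] (ν : Measure X) : Prop :=
  ν {x | 0 < ν {x}} = 1

/-- Shannon entropy of a countable measurable partition (recorded as a countably-valued
function), with values in `[0, ∞]`. -/
noncomputable def Hpart {X I : Type*} [MeasurableSpace X] [Countable I]
    (μ : Measure X) (a : X → I) : ℝ≥0∞ :=
  ∑' i : I, ENNReal.ofReal (Real.negMulLog (μ (a ⁻¹' {i})).toReal)

/-- Conditional Shannon entropy of a countable partition given a sub-σ-algebra `m`:
`H(α/m) = ∫ ∑_{A ∈ α} φ(E[1_A | m](x)) dμ(x)` with `φ(t) = -t log t`. -/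
noncomputable def condEntS {X I : Type*} (m : MeasurableSpace X) [mX : MeasurableSpace X]
    [Countable I] (μ : Measure X) (a : X → I) : ℝ≥0∞ :=
  ∫⁻ x, ∑' i : I,
    ENNReal.ofReal (Real.negMulLog ((μ[(a ⁻¹' {i}).indicator (fun _ => (1:ℝ)) | m]) x)) ∂μ

/-- Conditional Shannon entropy of a partition given another partition:
`H(α/β) = ∑_{B ∈ β} ∑_{A ∈ α} -μ(B) · (μ(A∩B)/μ(B)) · log (μ(A∩B)/μ(B))`
(equivalently `H(α ∨ β) − H(β)`), with values in `[0, ∞]`. -/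
noncomputable def condEntP {X I J : Type*} [MeasurableSpace X] [Countable I] [Countable J]
    (μ : Measure X) (a : X → I) (b : X → J) : ℝ≥0∞ :=
  ∑' q : I × J, μ (b ⁻¹' {q.2}) *
    ENNReal.ofReal (Real.negMulLog
      ((μ (a ⁻¹' {q.1} ∩ b ⁻¹' {q.2})).toReal / (μ (b ⁻¹' {q.2})).toReal))

/-- `F_G(X, μ, S, β) = (1-2r)·H(β) + ∑_{s ∈ S} H(s·β ∨ β)`. -/
noncomputable def FF {r : ℕ} {X I : Type*} [MeasurableSpace X] [Countable I]
    (μ : Measure X) (T : BorelAction (FG r) X) (b : X → I) : ℝ :=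
  (1 - 2 * (r : ℝ)) * (Hpart μ b).toReal
    + ∑ i : Fin r, (Hpart μ (fun x => (T.tr (FreeGroup.of i) b x, b x))).toReal

/-- The sequence `n ↦ F_G(X, μ, S, B_n · α)`. -/
noncomputable def fSeq {r : ℕ} {X : Type*} [MeasurableSpace X]
    (μ : Measure X) (T : BorelAction (FG r) X) (a : X → ℕ) (n : ℕ) : ℝ :=
  FF μ T (T.joinF (ball r n) a)

/-- The f-invariant entropy `f_G(X, μ) = lim_n F_G(X, μ, S, B_n·α)`, the limit (= infimum,
since the sequence is non-increasing) of the sequence `fSeq`, with values in `[-∞, ∞)`. -/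
noncomputable def fInv {r : ℕ} {X : Type*} [MeasurableSpace X]
    (μ : Measure X) (T : BorelAction (FG r) X) (a : X → ℕ) : EReal :=
  ⨅ n : ℕ, ((fSeq μ T a n : ℝ) : EReal)

/-- Relative version `F_G(X, μ/Σ, S, β) = (1-2r)·H(β/Σ) + ∑_{s ∈ S} H(s·β ∨ β / Σ)`. -/
noncomputable def FFrel {r : ℕ} {X I : Type*} (m : MeasurableSpace X) [mX : MeasurableSpace X]
    [Countable I] (μ : Measure X) (T : BorelAction (FG r) X) (b : X → I) : ℝ :=
  (1 - 2 * (r : ℝ)) * (condEntS m μ b).toReal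
    + ∑ i : Fin r, (condEntS m μ (fun x => (T.tr (FreeGroup.of i) b x, b x))).toReal

/-- The sequence `n ↦ F_G(X, μ/Σ, S, B_n · α)`. -/
noncomputable def fSeqRel {r : ℕ} {X : Type*} (m : MeasurableSpace X) [mX : MeasurableSpace X]
    (μ : Measure X) (T : BorelAction (FG r) X) (a : X → ℕ) (n : ℕ) : ℝ :=
  FFrel m μ T (T.joinF (ball r n) a)

/-- The relative f-invariant entropy `f_G(X, μ/Σ)`, with values in `[-∞, ∞)`. -/
noncomputable def fInvRel {r : ℕ} {X : Type*} (m : MeasurableSpace X) [mX : MeasurableSpace X]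
    (μ : Measure X) (T : BorelAction (FG r) X) (a : X → ℕ) : EReal :=
  ⨅ n : ℕ, ((fSeqRel m μ T a n : ℝ) : EReal)

/-- A total order on `S ∪ S⁻¹` is recorded by an injection `ord : Fin r × Bool → ℕ`;
`g ≺ h` iff `|g| < |h|`, or `|g| = |h|` and the reduced word of `g` lexicographically
precedes that of `h`. -/
def wlt {r : ℕ} (ord : Fin r × Bool → ℕ) (g h : FG r) : Prop :=
  wlen g < wlen h ∨ (wlen g = wlen h ∧ List.Lex (fun p q => ord p < ord q) g.toWord h.toWord)

/-- `Pre(g)`: the set of elements strictly preceding `g`. -/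
def Pre {r : ℕ} (ord : Fin r × Bool → ℕ) (g : FG r) : Set (FG r) := {h | wlt ord h g}

/-- The generator or inverse generator corresponding to a letter. -/
def letter {r : ℕ} (p : Fin r × Bool) : FG r :=
  if p.2 then FreeGroup.of p.1 else (FreeGroup.of p.1)⁻¹

/-- The first (leftmost) letter of the reduced word of `g` (junk value `1` for `g = 1`). -/
def firstLetter {r : ℕ} (g : FG r) : FG r := ((g.toWord.head?).map letter).getD 1

/-- The independence decay `δ(g, α/Σ)`, as a real number:
`δ(g, α/Σ) = H(s⁻¹g·α / Pre(s⁻¹g)·α ∨ Σ) − H(g·α / Pre(g)·α ∨ Σ)` where `s` is the first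
letter of `g`. -/
noncomputable def idecay {r : ℕ} {X I : Type*} (m : MeasurableSpace X) [mX : MeasurableSpace X]
    [Countable I] (μ : Measure X) (T : BorelAction (FG r) X)
    (ord : Fin r × Bool → ℕ) (a : X → I) (g : FG r) : ℝ :=
  (condEntS (m ⊔ T.partSA (Pre ord ((firstLetter g)⁻¹ * g)) a) μ
      (T.tr ((firstLetter g)⁻¹ * g) a)).toReal
  - (condEntS (m ⊔ T.partSA (Pre ord g) a) μ (T.tr g a)).toReal

/-- The entropy `H(τ)` of a probability space: the supremum of the Shannon entropies of
finite measurable partitions. -/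
noncomputable def measEnt {M : Type*} [MeasurableSpace M] (τ : Measure M) : ℝ≥0∞ :=
  ⨆ (P : Finset (Set M)) (_ : ∀ p ∈ P, MeasurableSet p)
    (_ : (P : Set (Set M)).PairwiseDisjoint id) (_ : ⋃₀ (P : Set (Set M)) = Set.univ),
    ∑ p ∈ P, ENNReal.ofReal (Real.negMulLog (τ p).toReal)

/-- The non-negative part of an extended real, in `ℝ≥0∞`. -/
noncomputable def erealToENNReal (x : EReal) : ℝ≥0∞ :=
  if x = ⊤ then ⊤ else ENNReal.ofReal x.toReal

/-- The integral of an `EReal`-valued function (positive part minus negative part),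
with values in `[-∞, ∞]`. -/
noncomputable def eIntegral {M : Type*} [MeasurableSpace M] (τ : Measure M) (f : M → EReal) :
    EReal :=
  ((∫⁻ m, erealToENNReal (f m) ∂τ : ℝ≥0∞) : EReal)
    - ((∫⁻ m, erealToENNReal (-(f m)) ∂τ : ℝ≥0∞) : EReal)

/-- The set of `G`-invariant Borel probability measures on `X`. -/
def InvProb {G X : Type*} [Group G] [MeasurableSpace X] (T : BorelAction G X) :
    Set (Measure X) :=
  {ν | IsProbabilityMeasure ν ∧ ∀ g : G, MeasurePreserving (T.act g) ν ν}

section Entropy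

variable {X I J K L : Type*} [MeasurableSpace X]

/-- The Shannon entropy of a partition as the integral of its information function; it agrees
with `Hpart` for countable measurable partitions. -/
noncomputable def ent (μ : Measure X) (b : X → I) : ℝ≥0∞ :=
  ∫⁻ x, ENNReal.ofReal (-Real.log (μ.real (b ⁻¹' {b x}))) ∂μ

lemma lintegral_comp_eq_tsum [Countable I] [MeasurableSpace I] [MeasurableSingletonClass I]
    (μ : Measure X) {b : X → I} (hb : Measurable b) (g : I → ℝ≥0∞) :
    ∫⁻ x, g (b x) ∂μ = ∑' i, g i * μ (b ⁻¹' {i}) := by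
  rw [← lintegral_map (measurable_of_countable g) hb, lintegral_countable']
  refine tsum_congr fun i => ?_
  rw [Measure.map_apply hb (measurableSet_singleton i)]

lemma Hpart_eq_ent [Countable I] [MeasurableSpace I] [MeasurableSingletonClass I]
    (μ : Measure X) [IsFiniteMeasure μ] {b : X → I} (hb : Measurable b) :
    Hpart μ b = ent μ b := by
  unfold ent
  rw [lintegral_comp_eq_tsum μ hb
    (fun i => ENNReal.ofReal (-Real.log (μ.real (b ⁻¹' {i}))))]
  refine tsum_congr fun i => ?_
  rw [← ofReal_measureReal (μ := μ) (s := b ⁻¹' {i}), mul_comm,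
    ← ENNReal.ofReal_mul measureReal_nonneg, Real.negMulLog,
    ENNReal.toReal_ofReal measureReal_nonneg]
  ring_nf

lemma ae_fiber_ne_zero [Countable I] (μ : Measure X) (b : X → I) :
    ∀ᵐ x ∂μ, μ (b ⁻¹' {b x}) ≠ 0 := by
  have h : {x | ¬ μ (b ⁻¹' {b x}) ≠ 0} ⊆ ⋃ i ∈ {i | μ (b ⁻¹' {i}) = 0}, b ⁻¹' {i} := by
    intro x hx
    simp only [ne_eq, not_not, mem_ofPred_eq] at hx
    exact mem_biUnion (show b x ∈ {i | μ (b ⁻¹' {i}) = 0} from hx) rfl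
  exact measure_mono_null h ((measure_biUnion_null_iff (to_countable _)).2 fun i hi => hi)

lemma ent_congr_ae (μ : Measure X) {b c : X → I} (h : b =ᵐ[μ] c) : ent μ b = ent μ c := by
  refine lintegral_congr_ae ?_
  filter_upwards [h] with x hx
  have : (b ⁻¹' {b x} : Set X) =ᵐ[μ] (c ⁻¹' {c x} : Set X) := by
    filter_upwards [h] with y hy
    change (b y = b x) = (c y = c x)
    rw [hx, hy]
  rw [measureReal_congr this]

lemma ent_le_of_factorsThrough [Countable I] (μ : Measure X) [IsFiniteMeasure μ]
    {b : X → I} {c : X → J} (h : c.FactorsThrough b) : ent μ c ≤ ent μ b := by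
  refine lintegral_mono_ae ?_
  filter_upwards [ae_fiber_ne_zero μ b] with x hx
  refine ENNReal.ofReal_le_ofReal (neg_le_neg (Real.log_le_log ?_ ?_))
  · exact ENNReal.toReal_pos hx (measure_ne_top _ _)
  · exact measureReal_mono fun y hy => h hy

lemma ent_eq_of_factorsThrough [Countable I] [Countable J] (μ : Measure X) [IsFiniteMeasure μ]
    {b : X → I} {c : X → J} (h : c.FactorsThrough b) (h' : b.FactorsThrough c) :
    ent μ c = ent μ b :=
  le_antisymm (ent_le_of_factorsThrough μ h) (ent_le_of_factorsThrough μ h')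

lemma ent_const (μ : Measure X) [IsProbabilityMeasure μ] (i : I) : ent μ (fun _ => i) = 0 := by
  simp [ent, preimage_const_of_mem]

lemma tsum_measure_fiber_inter [Countable I] [MeasurableSpace I] [MeasurableSingletonClass I]
    (μ : Measure X) {b : X → I} (hb : Measurable b) {s : Set X} (hs : MeasurableSet s) :
    ∑' i, μ (b ⁻¹' {i} ∩ s) = μ s := by
  rw [← measure_iUnion]
  · congr 1
    ext x
    simp
  · intro i j hij
    refine Disjoint.mono inter_subset_left inter_subset_left ?_
    exact Disjoint.preimage b (by simpa using hij)
  · exact fun i => (hb (measurableSet_singleton i)).inter hs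

lemma neg_log_add_neg_log_add_one_le {p q s t : ℝ} (hp : 0 < p) (hq : p ≤ q) (hs : p ≤ s)
    (ht : q ≤ t) (ht1 : t ≤ 1) (hs1 : s ≤ 1) :
    ENNReal.ofReal (-Real.log p) + ENNReal.ofReal (-Real.log t) + 1 ≤
      ENNReal.ofReal (-Real.log q) + ENNReal.ofReal (-Real.log s)
        + ENNReal.ofReal (q * s / (t * p)) := by
  have hq0 := hp.trans_le hq
  have hs0 := hp.trans_le hs
  have ht0 := hq0.trans_le ht
  have nn : ∀ {u : ℝ}, 0 < u → u ≤ 1 → 0 ≤ -Real.log u := fun h0 h1 => by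
    linarith [Real.log_nonpos h0.le h1]
  have h1 := nn hp (hs.trans hs1)
  have h2 := nn ht0 ht1
  have h3 := nn hq0 (ht.trans ht1)
  have h4 := nn hs0 hs1
  have h5 : 0 < q * s / (t * p) := by positivity
  rw [← ENNReal.ofReal_one, ← ENNReal.ofReal_add h1 h2, ← ENNReal.ofReal_add (by positivity)
    zero_le_one, ← ENNReal.ofReal_add h3 h4, ← ENNReal.ofReal_add (by positivity) h5.le]
  refine ENNReal.ofReal_le_ofReal ?_
  have h6 := Real.log_le_sub_one_of_pos h5
  rw [Real.log_div (by positivity) (by positivity), Real.log_mul hq0.ne' hs0.ne',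
    Real.log_mul ht0.ne' hp.ne'] at h6
  linarith

variable [Countable I] [MeasurableSpace I] [MeasurableSingletonClass I]
  [Countable J] [MeasurableSpace J] [MeasurableSingletonClass J]
  [Countable K] [MeasurableSpace K] [MeasurableSingletonClass K]

lemma lintegral_condIndep_ratio_le_one (μ : Measure X) [IsProbabilityMeasure μ]
    {a : X → I} {b : X → J} {c : X → K} (ha : Measurable a) (hb : Measurable b)
    (hc : Measurable c) :
    ∫⁻ x, ENNReal.ofReal
      (μ.real ((fun y => (a y, c y)) ⁻¹' {(a x, c x)})
        * μ.real ((fun y => (b y, c y)) ⁻¹' {(b x, c x)})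
        / (μ.real (c ⁻¹' {c x}) * μ.real ((fun y => (a y, b y, c y)) ⁻¹' {(a x, b x, c x)}))) ∂μ
      ≤ 1 := by
  have habc : Measurable fun y => (a y, b y, c y) := ha.prodMk (hb.prodMk hc)
  rw [lintegral_comp_eq_tsum μ habc (fun t : I × J × K => ENNReal.ofReal
      (μ.real ((fun y => (a y, c y)) ⁻¹' {(t.1, t.2.2)})
        * μ.real ((fun y => (b y, c y)) ⁻¹' {(t.2.1, t.2.2)})
        / (μ.real (c ⁻¹' {t.2.2}) * μ.real ((fun y => (a y, b y, c y)) ⁻¹' {t}))))]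
  have hle : ∀ t : I × J × K, ENNReal.ofReal
      (μ.real ((fun y => (a y, c y)) ⁻¹' {(t.1, t.2.2)})
        * μ.real ((fun y => (b y, c y)) ⁻¹' {(t.2.1, t.2.2)})
        / (μ.real (c ⁻¹' {t.2.2}) * μ.real ((fun y => (a y, b y, c y)) ⁻¹' {t})))
        * μ ((fun y => (a y, b y, c y)) ⁻¹' {t}) ≤
      μ (a ⁻¹' {t.1} ∩ c ⁻¹' {t.2.2}) * (μ (b ⁻¹' {t.2.1} ∩ c ⁻¹' {t.2.2})
        * (μ (c ⁻¹' {t.2.2}))⁻¹) := by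
    rintro ⟨i, j, k⟩
    by_cases h0 : μ ((fun y => (a y, b y, c y)) ⁻¹' {(i, j, k)}) = 0
    · simp [h0]
    have e1 : (fun y => (a y, c y)) ⁻¹' {(i, k)} = a ⁻¹' {i} ∩ c ⁻¹' {k} := by ext; simp
    have e2 : (fun y => (b y, c y)) ⁻¹' {(j, k)} = b ⁻¹' {j} ∩ c ⁻¹' {k} := by ext; simp
    have hk : μ (c ⁻¹' {k}) ≠ 0 := fun h => h0 (measure_mono_null (fun y hy => by
      simp only [mem_preimage, mem_singleton_iff, Prod.mk.injEq] at hy ⊢; exact hy.2.2) h)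
    have hk' : 0 < μ.real (c ⁻¹' {k}) := ENNReal.toReal_pos hk (measure_ne_top _ _)
    have h0' : 0 < μ.real ((fun y => (a y, b y, c y)) ⁻¹' {(i, j, k)}) :=
      ENNReal.toReal_pos h0 (measure_ne_top _ _)
    refine le_of_eq ?_
    dsimp only
    rw [e1, e2]
    have hreal : ∀ s, μ s = ENNReal.ofReal (μ.real s) := fun s =>
      (ofReal_measureReal (μ := μ) (s := s)).symm
    simp only [hreal]
    rw [← ENNReal.ofReal_mul (by positivity), ← ENNReal.ofReal_inv_of_pos hk',
      ← ENNReal.ofReal_mul (by positivity), ← ENNReal.ofReal_mul (by positivity)]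
    congr 1
    field_simp
  refine (ENNReal.tsum_le_tsum hle).trans ?_
  rw [ENNReal.tsum_prod']
  simp_rw [ENNReal.tsum_prod']
  rw [ENNReal.tsum_comm]
  calc ∑' (j : J) (i : I) (k : K), μ (a ⁻¹' {i} ∩ c ⁻¹' {k}) * (μ (b ⁻¹' {j} ∩ c ⁻¹' {k})
        * (μ (c ⁻¹' {k}))⁻¹)
      = ∑' (j : J) (k : K), μ (c ⁻¹' {k}) * (μ (b ⁻¹' {j} ∩ c ⁻¹' {k})
        * (μ (c ⁻¹' {k}))⁻¹) := by
        refine tsum_congr fun j => ?_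
        rw [ENNReal.tsum_comm]
        refine tsum_congr fun k => ?_
        rw [ENNReal.tsum_mul_right,
          tsum_measure_fiber_inter μ ha (hc (measurableSet_singleton k))]
    _ ≤ ∑' (j : J) (k : K), μ (b ⁻¹' {j} ∩ c ⁻¹' {k}) := by
        refine ENNReal.tsum_le_tsum fun j => ENNReal.tsum_le_tsum fun k => ?_
        rw [mul_left_comm]
        exact mul_le_of_le_one_right' (ENNReal.mul_inv_le_one _)
    _ = ∑' (k : K), μ (c ⁻¹' {k} ∩ univ) := by
        rw [ENNReal.tsum_comm]
        refine tsum_congr fun k => ?_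
        rw [tsum_measure_fiber_inter μ hb (hc (measurableSet_singleton k)), inter_univ]
    _ = 1 := by rw [tsum_measure_fiber_inter μ hc MeasurableSet.univ, measure_univ]

lemma measurable_information (μ : Measure X) {b : X → I} (hb : Measurable b) :
    Measurable fun x => ENNReal.ofReal (-Real.log (μ.real (b ⁻¹' {b x}))) :=
  (measurable_of_countable
    (fun i : I => ENNReal.ofReal (-Real.log (μ.real (b ⁻¹' {i}))))).comp hb

lemma ent_triple_add_ent_le (μ : Measure X) [IsProbabilityMeasure μ]
    {a : X → I} {b : X → J} {c : X → K} (ha : Measurable a) (hb : Measurable b)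
    (hc : Measurable c) :
    ent μ (fun x => (a x, b x, c x)) + ent μ c
      ≤ ent μ (fun x => (a x, c x)) + ent μ (fun x => (b x, c x)) := by
  have habc : Measurable fun y => (a y, b y, c y) := ha.prodMk (hb.prodMk hc)
  have key : ent μ (fun x => (a x, b x, c x)) + ent μ c + 1
      ≤ ent μ (fun x => (a x, c x)) + ent μ (fun x => (b x, c x)) + 1 := by
    refine le_trans ?_ (add_le_add_right (lintegral_condIndep_ratio_le_one μ ha hb hc) _)
    have h1 : (1 : ℝ≥0∞) = ∫⁻ _, 1 ∂μ := by simp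
    unfold ent
    conv_lhs => rw [h1]
    rw [← lintegral_add_left (measurable_information μ habc),
      ← lintegral_add_left (measurable_information μ (ha.prodMk hc)),
      ← lintegral_add_left ((measurable_information μ habc).fun_add (measurable_information μ hc)),
      ← lintegral_add_left ((measurable_information μ (ha.prodMk hc)).fun_add
        (measurable_information μ (hb.prodMk hc)))]
    refine lintegral_mono_ae ?_
    filter_upwards [ae_fiber_ne_zero μ fun x => (a x, b x, c x)] with x hx
    refine neg_log_add_neg_log_add_one_le (ENNReal.toReal_pos hx (measure_ne_top _ _))
      (measureReal_mono ?_) (measureReal_mono ?_) (measureReal_mono ?_)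
      measureReal_le_one measureReal_le_one
    all_goals
      intro y hy
      simp only [mem_preimage, mem_singleton_iff, Prod.mk.injEq] at hy ⊢
      tauto
  exact (ENNReal.add_le_add_iff_right ENNReal.one_ne_top).1 key

/-- Submodularity of Shannon entropy. -/
lemma ent_submodular (μ : Measure X) [IsProbabilityMeasure μ]
    {a : X → I} {b : X → J} {c : X → K} {d : X → L} (ha : Measurable a) (hb : Measurable b)
    (hc : Measurable c) (hca : c.FactorsThrough a) (hcb : c.FactorsThrough b)
    (hd : d.FactorsThrough fun x => (a x, b x)) :
    ent μ d + ent μ c ≤ ent μ a + ent μ b := by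
  refine (add_le_add_left (ent_le_of_factorsThrough μ
    (b := fun x => (a x, b x, c x)) ?_) _).trans
    ((ent_triple_add_ent_le μ ha hb hc).trans (add_le_add
      (ent_le_of_factorsThrough μ ?_) (ent_le_of_factorsThrough μ ?_)))
  · intro x y h
    simp only [Prod.mk.injEq] at h
    exact hd (Prod.ext h.1 h.2.1)
  · exact fun x y h => Prod.ext h (hca h)
  · exact fun x y h => Prod.ext h (hcb h)

lemma ent_prod_le (μ : Measure X) [IsProbabilityMeasure μ] {a : X → I} {b : X → J}
    (ha : Measurable a) (hb : Measurable b) :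
    ent μ (fun x => (a x, b x)) ≤ ent μ a + ent μ b := by
  have := ent_submodular μ (c := fun _ => ()) (d := fun x => (a x, b x)) ha hb measurable_const
    (fun _ _ _ => rfl) (fun _ _ _ => rfl) (fun _ _ h => h)
  rwa [ent_const, add_zero] at this

lemma ent_comp_measurePreserving (μ : Measure X) {g : X → X} (hg : MeasurePreserving g μ μ)
    {b : X → I} (hb : Measurable b) : ent μ (fun x => b (g x)) = ent μ b := by
  unfold ent
  rw [← hg.lintegral_comp (measurable_information μ hb)]
  refine lintegral_congr fun x => ?_
  rw [← hg.measureReal_preimage (hb (measurableSet_singleton (b (g x)))).nullMeasurableSet]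
  rfl

lemma ent_lt_top_of_finite [Finite I] (μ : Measure X) [IsFiniteMeasure μ] {b : X → I}
    (hb : Measurable b) : ent μ b < ⊤ := by
  have := Fintype.ofFinite I
  rw [← Hpart_eq_ent μ hb, Hpart, tsum_fintype]
  exact ENNReal.sum_lt_top.2 fun i _ => ENNReal.ofReal_lt_top

end Entropy

section Monotone

variable {r : ℕ} {X I : Type*} [MeasurableSpace X] [Countable I] [MeasurableSpace I]
  [MeasurableSingletonClass I]

lemma measurable_tr {T : BorelAction (FG r) X} {J : Type*} [MeasurableSpace J] {a : X → J}
    (ha : Measurable a) (g : FG r) : Measurable (T.tr g a) :=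
  ha.comp (T.measurable_act _)

lemma measurable_joinF {T : BorelAction (FG r) X} {J : Type*} [MeasurableSpace J] {a : X → J}
    (ha : Measurable a) (F : Set (FG r)) : Measurable (T.joinF F a) :=
  measurable_pi_lambda _ fun f => measurable_tr ha (f : FG r)

omit [Countable I] [MeasurableSpace I] [MeasurableSingletonClass I] in
lemma joinF_factorsThrough (T : BorelAction (FG r) X) {E F : Set (FG r)} (h : E ⊆ F)
    (a : X → I) : (T.joinF E a).FactorsThrough (T.joinF F a) :=
  fun _ _ hxy => funext fun e => congrFun hxy ⟨e, h e.2⟩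

omit [Countable I] [MeasurableSpace I] [MeasurableSingletonClass I] in
lemma joinF_apply_eq_iff (T : BorelAction (FG r) X) (F : Set (FG r)) (a : X → I) (x y : X) :
    T.joinF F a x = T.joinF F a y ↔ ∀ f ∈ F, a (T.act f⁻¹ x) = a (T.act f⁻¹ y) :=
  ⟨fun h f hf => congrFun h ⟨f, hf⟩, fun h => funext fun f => h f f.2⟩

omit [Countable I] [MeasurableSpace I] [MeasurableSingletonClass I] in
lemma tr_joinF_apply_eq_iff (T : BorelAction (FG r) X) (g : FG r) (F : Set (FG r)) (a : X → I)
    (x y : X) : T.tr g (T.joinF F a) x = T.tr g (T.joinF F a) y ↔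
      T.joinF (g • F) a x = T.joinF (g • F) a y := by
  simp only [BorelAction.tr, joinF_apply_eq_iff, ← T.act_mul, ← mul_inv_rev]
  constructor
  · rintro h _ ⟨f, hf, rfl⟩
    exact h f hf
  · exact fun h f hf => h _ (smul_mem_smul_set hf)

/-- The entropy of the join of the translates of `a` over `F`, as a real number. -/
noncomputable def joinEnt (μ : Measure X) (T : BorelAction (FG r) X) (a : X → I)
    (F : Set (FG r)) : ℝ := (ent μ (T.joinF F a)).toReal

variable (μ : Measure X) [IsProbabilityMeasure μ] (T : BorelAction (FG r) X) {a : X → I}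

omit [IsProbabilityMeasure μ] in
lemma ent_tr (hT : T.Preserves μ) (ha : Measurable a) (g : FG r) :
    ent μ (T.tr g a) = ent μ a :=
  ent_comp_measurePreserving μ (hT g⁻¹) ha

lemma ent_joinF_lt_top (hT : T.Preserves μ) (ha : Measurable a) (hent : ent μ a < ⊤)
    {F : Set (FG r)} (hF : F.Finite) : ent μ (T.joinF F a) < ⊤ := by
  induction F, hF using Set.Finite.induction_on with
  | empty =>
    have : ent μ (T.joinF ∅ a) = ent μ (fun _ : X => ()) :=
      ent_eq_of_factorsThrough μ (fun _ _ _ => Subsingleton.elim _ _) (fun _ _ _ => rfl)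
    rw [this, ent_const]
    exact ENNReal.zero_lt_top
  | @insert g F _ hF ih =>
    have := hF.to_subtype
    refine ((ent_le_of_factorsThrough μ (b := fun x => (T.tr g a x, T.joinF F a x)) ?_).trans
      (ent_prod_le μ (measurable_tr ha g) (measurable_joinF ha F))).trans_lt
      (ENNReal.add_lt_top.2 ⟨(ent_tr μ T hT ha g).trans_lt hent, ih⟩)
    intro x y h
    rw [Prod.mk.injEq, joinF_apply_eq_iff] at h
    rw [joinF_apply_eq_iff]
    rintro f (rfl | hf)
    · exact h.1
    · exact h.2 f hf

variable {μ T} (hT : T.Preserves μ) (ha : Measurable a) (hent : ent μ a < ⊤)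
include hT ha hent

lemma joinEnt_submodular {A B C D : Set (FG r)} (hA : A.Finite) (hB : B.Finite) (hCA : C ⊆ A)
    (hCB : C ⊆ B) (hD : D ⊆ A ∪ B) :
    joinEnt μ T a D + joinEnt μ T a C ≤ joinEnt μ T a A + joinEnt μ T a B := by
  have fin := fun {F : Set (FG r)} (hF : F.Finite) => (ent_joinF_lt_top μ T hT ha hent hF).ne
  have hD' := (hA.union hB).subset hD
  have hC' := hA.subset hCA
  have := hA.to_subtype
  have := hB.to_subtype
  have := hC'.to_subtype
  unfold joinEnt
  rw [← ENNReal.toReal_add (fin hD') (fin hC'), ← ENNReal.toReal_add (fin hA) (fin hB)]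
  refine ENNReal.toReal_mono (ENNReal.add_ne_top.2 ⟨fin hA, fin hB⟩)
    (ent_submodular μ (measurable_joinF ha A) (measurable_joinF ha B) (measurable_joinF ha C)
      (joinF_factorsThrough T hCA a) (joinF_factorsThrough T hCB a) ?_)
  intro x y h
  rw [Prod.mk.injEq, joinF_apply_eq_iff, joinF_apply_eq_iff] at h
  rw [joinF_apply_eq_iff]
  intro f hf
  exact (hD hf).elim (h.1 f) (h.2 f)

omit hent in
lemma joinEnt_smul (g : FG r) {F : Set (FG r)} (hF : F.Finite) :
    joinEnt μ T a (g • F) = joinEnt μ T a F := by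
  have := hF.to_subtype
  have := (hF.smul_set (a := g)).to_subtype
  unfold joinEnt
  rw [← ent_tr μ T hT (measurable_joinF ha F) g]
  congr 1
  exact ent_eq_of_factorsThrough μ (fun x y => (tr_joinF_apply_eq_iff T g F a x y).1)
    (fun x y => (tr_joinF_apply_eq_iff T g F a x y).2)

omit hT hent in
lemma FF_joinF {F : Set (FG r)} [Finite F] :
    FF μ T (T.joinF F a) = (1 - 2 * (r : ℝ)) * joinEnt μ T a F
      + ∑ i : Fin r, joinEnt μ T a (F ∪ FreeGroup.of i • F) := by
  have hF := measurable_joinF (T := T) ha F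
  unfold FF
  rw [Hpart_eq_ent μ hF]
  congr 1
  refine Finset.sum_congr rfl fun i _ => ?_
  rw [Hpart_eq_ent μ ((measurable_tr hF _).prodMk hF)]
  unfold joinEnt
  congr 1
  have := ((toFinite F).smul_set (a := FreeGroup.of i)).to_subtype
  have key : ∀ x y, (T.tr (FreeGroup.of i) (T.joinF F a) x, T.joinF F a x)
      = (T.tr (FreeGroup.of i) (T.joinF F a) y, T.joinF F a y) ↔
      T.joinF (F ∪ FreeGroup.of i • F) a x = T.joinF (F ∪ FreeGroup.of i • F) a y := by
    intro x y
    rw [Prod.mk.injEq, tr_joinF_apply_eq_iff, joinF_apply_eq_iff, joinF_apply_eq_iff,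
      joinF_apply_eq_iff]
    constructor
    · rintro ⟨h1, h2⟩ f (hf | hf)
      exacts [h2 f hf, h1 f hf]
    · exact fun h => ⟨fun f hf => h f (Or.inr hf), fun f hf => h f (Or.inl hf)⟩
  exact ent_eq_of_factorsThrough μ (fun x y => (key x y).2) (fun x y => (key x y).1)

lemma joinEnt_union_smul_le_add_two {F F' : Set (FG r)} (hF' : F'.Finite) (h : F ⊆ F')
    (s : FG r) : joinEnt μ T a (F' ∪ s • F') ≤ joinEnt μ T a (F ∪ s • F)
      + 2 * (joinEnt μ T a F' - joinEnt μ T a F) := by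
  have hF := hF'.subset h
  have hs : s • F ⊆ s • F' := smul_set_mono h
  have h1 := joinEnt_submodular hT ha hent (A := F' ∪ s • F) (B := F ∪ s • F')
    (C := F ∪ s • F) (D := F' ∪ s • F') (hF'.union hF.smul_set) (hF.union hF'.smul_set)
    (union_subset_union_left _ h) (union_subset_union_right _ hs)
    (union_subset (subset_union_left.trans subset_union_left)
      (subset_union_right.trans subset_union_right))
  have h2 := joinEnt_submodular hT ha hent (A := F') (B := F ∪ s • F)
    (C := F) (D := F' ∪ s • F) hF' (hF.union hF.smul_set) h subset_union_left
    (union_subset_union_right _ subset_union_right)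
  have h3 := joinEnt_submodular hT ha hent (A := s • F') (B := F ∪ s • F)
    (C := s • F) (D := F ∪ s • F') hF'.smul_set (hF.union hF.smul_set) hs subset_union_right
    (union_subset (subset_union_left.trans subset_union_right) subset_union_left)
  rw [joinEnt_smul hT ha s hF, joinEnt_smul hT ha s hF'] at h3
  linarith

lemma joinEnt_union_smul_le_add {F F' : Set (FG r)} (hF' : F'.Finite) (h : F ⊆ F')
    {s : FG r} (hs : F' ⊆ F ∪ s • F ∨ F' ⊆ F ∪ s⁻¹ • F) :
    joinEnt μ T a (F' ∪ s • F') ≤ joinEnt μ T a (F ∪ s • F)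
      + (joinEnt μ T a F' - joinEnt μ T a F) := by
  have hF := hF'.subset h
  have hsF : s • F ⊆ s • F' := smul_set_mono h
  rcases hs with hs | hs
  · have h3 := joinEnt_submodular hT ha hent (A := s • F') (B := F ∪ s • F)
      (C := s • F) (D := F' ∪ s • F') hF'.smul_set (hF.union hF.smul_set) hsF
      subset_union_right (union_subset (hs.trans subset_union_right) subset_union_left)
    rw [joinEnt_smul hT ha s hF, joinEnt_smul hT ha s hF'] at h3
    linarith
  · have hs' : s • F' ⊆ F ∪ s • F := by
      have := smul_set_mono (a := s) hs
      rwa [smul_set_union, smul_inv_smul, union_comm] at this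
    have h2 := joinEnt_submodular hT ha hent (A := F') (B := F ∪ s • F)
      (C := F) (D := F' ∪ s • F') hF' (hF.union hF.smul_set) h subset_union_left
      (union_subset_union_right _ hs')
    linarith

/-- `F_G` does not increase under a simple splitting. -/
lemma FF_joinF_le_of_splitting {F F' : Set (FG r)} [Finite F] [Finite F'] (h : F ⊆ F')
    (p : Fin r × Bool) (hp : F' ⊆ F ∪ letter p • F) :
    FF μ T (T.joinF F' a) ≤ FF μ T (T.joinF F a) := by
  have hF' := toFinite F'
  rw [FF_joinF ha, FF_joinF ha]
  set d := joinEnt μ T a F' - joinEnt μ T a F with hd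
  have hsum : ∑ i : Fin r, joinEnt μ T a (F' ∪ FreeGroup.of i • F')
      ≤ ∑ i : Fin r, (joinEnt μ T a (F ∪ FreeGroup.of i • F)
        + (2 * d - if i = p.1 then d else 0)) := by
    refine Finset.sum_le_sum fun i _ => ?_
    split_ifs with hi
    · refine (joinEnt_union_smul_le_add hT ha hent hF' h ?_).trans (by linarith)
      rw [letter] at hp
      subst hi
      split_ifs at hp
      exacts [Or.inl hp, Or.inr hp]
    · exact (joinEnt_union_smul_le_add_two hT ha hent hF' h _).trans (by linarith)
  rw [Finset.sum_add_distrib, Finset.sum_sub_distrib, Finset.sum_ite_eq' Finset.univ p.1] at hsum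
  simp only [Finset.sum_const, Finset.card_univ, Fintype.card_fin, nsmul_eq_mul,
    Finset.mem_univ, if_true] at hsum
  rw [hd] at hsum
  linarith

omit hT ha hent in
lemma ball_mono (r : ℕ) {m n : ℕ} (h : m ≤ n) : ball r m ⊆ ball r n :=
  fun _ hg => le_trans (show wlen _ ≤ m from hg) h

omit hT ha hent in
lemma wlen_letter_mul_le (p : Fin r × Bool) (g : FG r) : wlen (letter p * g) ≤ wlen g + 1 := by
  have h : wlen (letter p) ≤ 1 := by
    unfold wlen letter
    split_ifs
    · simp
    · simp [FreeGroup.toWord_inv]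
  exact (FreeGroup.norm_mul_le _ _).trans (by change wlen _ + wlen _ ≤ _; omega)

omit hT ha hent in
lemma ball_succ_subset (n : ℕ) :
    ball r (n + 1) ⊆ ball r n ∪ ⋃ p : Fin r × Bool, letter p • ball r n := by
  intro g hg
  have hg' : g.toWord.length ≤ n + 1 := hg
  rcases hw : g.toWord with _ | ⟨p, l⟩
  · left
    change g.toWord.length ≤ n
    simp [hw]
  · right
    refine mem_iUnion.2 ⟨p, FreeGroup.mk l, ?_, ?_⟩
    · change (FreeGroup.mk l).toWord.length ≤ n
      rw [FreeGroup.toWord_mk]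
      have := (FreeGroup.reduce.red (L := l)).length_le
      rw [hw, List.length_cons] at hg'
      omega
    · change letter p * FreeGroup.mk l = g
      have hl : letter p = FreeGroup.mk [p] := by
        obtain ⟨i, b⟩ := p
        cases b <;> simp [letter, FreeGroup.of, FreeGroup.inv_mk, FreeGroup.invRev]
      rw [hl, FreeGroup.mul_mk, ← FreeGroup.mk_toWord (x := g), hw]
      rfl

/-- The sequence `n ↦ F_G(X, μ, S, B_n · α)` is non-increasing. -/
lemma FF_joinF_ball_antitone : Antitone fun n => FF μ T (T.joinF (ball r n) a) := by
  refine antitone_nat_of_succ_le fun n => ?_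
  have hball := toFinite (ball r n)
  have hstep : ∀ t : Finset (Fin r × Bool), ∀ E : Set (FG r), ∀ _ : Finite E,
      E = ball r n ∪ ⋃ p ∈ t, letter p • ball r n →
      FF μ T (T.joinF E a) ≤ FF μ T (T.joinF (ball r n) a) := by
    intro t
    induction t using Finset.induction_on with
    | empty =>
      intro E hE h
      simp only [Finset.notMem_empty, iUnion_of_empty, iUnion_empty, union_empty] at h
      subst h
      exact le_rfl
    | insert p t _ ih =>
      intro E hE h
      have hfin : Finite ↑(ball r n ∪ ⋃ q ∈ t, letter q • ball r n) := by
        refine (toFinite E).subset ?_ |>.to_subtype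
        rw [h, Finset.set_biUnion_insert]
        exact union_subset_union_right _ subset_union_right
      refine le_trans ?_ (ih _ hfin rfl)
      refine FF_joinF_le_of_splitting hT ha hent ?_ p ?_
      · rw [h, Finset.set_biUnion_insert]
        exact union_subset_union_right _ subset_union_right
      · rw [h, Finset.set_biUnion_insert]
        refine union_subset (subset_union_left.trans subset_union_left) (union_subset ?_ ?_)
        · exact (smul_set_mono subset_union_left).trans subset_union_right
        · exact subset_union_right.trans subset_union_left
  refine hstep Finset.univ _ inferInstance (Subset.antisymm ?_ ?_)
  · simpa using ball_succ_subset n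
  · refine union_subset (ball_mono r n.le_succ) (iUnion₂_subset fun p _ => ?_)
    rintro _ ⟨g, hg, rfl⟩
    exact (wlen_letter_mul_le p g).trans (Nat.succ_le_succ hg)

end Monotone

section Generating

variable {r : ℕ} {X I : Type*} [mX : MeasurableSpace X] [Countable I] [MeasurableSpace I]
  [MeasurableSingletonClass I] {T : BorelAction (FG r) X} {a : X → I}

lemma partSA_le (ha : Measurable a) (F : Set (FG r)) : T.partSA F a ≤ mX := by
  refine iSup₂_le fun f _ => ?_
  rintro _ ⟨S, -, rfl⟩
  exact measurable_tr ha f (to_countable S).measurableSet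

/-- The sets that are unions of cells of one of the partitions `B_n · α`. -/
def ballSets (T : BorelAction (FG r) X) (a : X → I) : Set (Set X) :=
  {B | ∃ n, (fun x => x ∈ B).FactorsThrough (T.joinF (ball r n) a)}

omit [Countable I] [MeasurableSpace I] [MeasurableSingletonClass I] in
lemma isSetRing_ballSets : IsSetRing (ballSets T a) := by
  have key : ∀ {s t : Set X}, s ∈ ballSets T a → t ∈ ballSets T a →
      ∃ n, (fun x => x ∈ s).FactorsThrough (T.joinF (ball r n) a) ∧
        (fun x => x ∈ t).FactorsThrough (T.joinF (ball r n) a) := by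
    rintro s t ⟨m, hm⟩ ⟨n, hn⟩
    exact ⟨max m n,
      fun x y h => hm (joinF_factorsThrough T (ball_mono r (le_max_left m n)) a h),
      fun x y h => hn (joinF_factorsThrough T (ball_mono r (le_max_right m n)) a h)⟩
  refine ⟨⟨0, fun _ _ _ => rfl⟩, fun s t hs ht => ?_, fun s t hs ht => ?_⟩
  · obtain ⟨n, h1, h2⟩ := key hs ht
    refine ⟨n, fun x y h => ?_⟩
    have e1 : (x ∈ s) = (y ∈ s) := h1 h
    have e2 : (x ∈ t) = (y ∈ t) := h2 h
    change (x ∈ s ∨ x ∈ t) = (y ∈ s ∨ y ∈ t)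
    rw [e1, e2]
  · obtain ⟨n, h1, h2⟩ := key hs ht
    refine ⟨n, fun x y h => ?_⟩
    have e1 : (x ∈ s) = (y ∈ s) := h1 h
    have e2 : (x ∈ t) = (y ∈ t) := h2 h
    change (x ∈ s ∧ x ∉ t) = (y ∈ s ∧ y ∉ t)
    rw [e1, e2]

lemma partSA_univ_eq_generateFrom_ballSets :
    T.partSA univ a = MeasurableSpace.generateFrom (ballSets T a) := by
  refine le_antisymm (iSup₂_le fun f _ => ?_) (MeasurableSpace.generateFrom_le ?_)
  · rintro _ ⟨S, -, rfl⟩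
    refine MeasurableSpace.measurableSet_generateFrom ⟨wlen f, fun x y h => ?_⟩
    have := (joinF_apply_eq_iff T _ a x y).1 h f (le_refl (wlen f))
    change (a (T.act f⁻¹ x) ∈ S) = (a (T.act f⁻¹ y) ∈ S)
    rw [this]
  · rintro B ⟨n, hn⟩
    have hB : B = T.joinF (ball r n) a ⁻¹' (T.joinF (ball r n) a '' B) := by
      refine Subset.antisymm (subset_preimage_image _ _) ?_
      rintro x ⟨y, hy, hxy⟩
      exact cast (hn hxy) hy
    have hm : Measurable[T.partSA univ a] (T.joinF (ball r n) a) := by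
      refine @measurable_pi_lambda _ _ _ (T.partSA univ a) _ _ fun f => ?_
      refine measurable_iff_comap_le.2 ((MeasurableSpace.comap_mono le_top).trans ?_)
      exact le_iSup₂_of_le (f := fun f (_ : f ∈ univ) => MeasurableSpace.comap (T.tr f a) ⊤)
        (f : FG r) (mem_univ _) le_rfl
    rw [hB]
    exact hm (to_countable _).measurableSet

lemma Generating.exists_ballSets_symmDiff_lt {μ : Measure X} [IsFiniteMeasure μ]
    (ha : Measurable a) (hgen : T.Generating a μ) {B : Set X} (hB : MeasurableSet B)
    {ε : ℝ≥0∞} (hε : 0 < ε) : ∃ B' ∈ ballSets T a, MeasurableSet B' ∧ μ (B' ∆ B) < ε := by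
  obtain ⟨C, hC, hBC⟩ := hgen B hB
  have hle := partSA_le (T := T) ha univ
  have hu : univ ∈ ballSets T a := ⟨0, fun _ _ _ => rfl⟩
  obtain ⟨B', hB', h⟩ := @exists_measure_symmDiff_lt_of_generateFrom_isSetRing X
    (T.partSA univ a) (μ.trim hle) _ _ isSetRing_ballSets
    ⟨{univ}, countable_singleton _, by simpa using hu, by simp⟩
    partSA_univ_eq_generateFrom_ballSets _ hC _ hε
  have hB'm : MeasurableSet[T.partSA univ a] B' := by
    rw [partSA_univ_eq_generateFrom_ballSets]
    exact MeasurableSpace.measurableSet_generateFrom hB'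
  rw [trim_measurableSet_eq hle (hB'm.symmDiff hC)] at h
  refine ⟨B', hB', hle _ hB'm, ?_⟩
  calc μ (B' ∆ B) ≤ μ (B' ∆ C) + μ (C ∆ B) := measure_symmDiff_le _ _ _
    _ = μ (B' ∆ C) := by rw [symmDiff_comm C B, hBC, add_zero]
    _ < ε := h

omit [Countable I] [MeasurableSpace I] [MeasurableSingletonClass I] in
lemma ent_mem_eq (μ : Measure X) [IsProbabilityMeasure μ] {D : Set X} (hD : MeasurableSet D) :
    ent μ (fun x => x ∈ D) = ENNReal.ofReal (Real.negMulLog (μ.real D))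
      + ENNReal.ofReal (Real.negMulLog (1 - μ.real D)) := by
  have h1 : (fun x => x ∈ D) ⁻¹' {True} = D := by ext; simp
  have h2 : (fun x => x ∈ D) ⁻¹' {False} = Dᶜ := by ext; simp
  have hm : Measurable fun x => x ∈ D := measurableSet_setOfPred.1 hD
  rw [← Hpart_eq_ent μ hm, Hpart, tsum_fintype, Fintype.univ_Prop]
  rw [Finset.sum_pair (by simp), h1, h2, ← probReal_compl_eq_one_sub hD]
  rfl

omit [Countable I] [MeasurableSpace I] [MeasurableSingletonClass I] in
lemma exists_forall_measure_lt_ent_mem_le {ε : ℝ≥0∞} (hε : 0 < ε) :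
    ∃ δ > 0, ∀ (μ : Measure X) [IsProbabilityMeasure μ] {D : Set X}, MeasurableSet D →
      μ D < δ → ent μ (fun x => x ∈ D) ≤ ε := by
  have hc : Continuous fun t : ℝ => ENNReal.ofReal (Real.negMulLog t)
      + ENNReal.ofReal (Real.negMulLog (1 - t)) :=
    (ENNReal.continuous_ofReal.comp Real.continuous_negMulLog).add
      (ENNReal.continuous_ofReal.comp
        (Real.continuous_negMulLog.comp (continuous_const.sub continuous_id)))
  have h0 := hc.tendsto 0
  simp only [Real.negMulLog_zero, sub_zero, Real.negMulLog_one, ENNReal.ofReal_zero,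
    add_zero] at h0
  obtain ⟨δ, hδ, h⟩ := Metric.eventually_nhds_iff.1 (h0.eventually (ge_mem_nhds hε))
  refine ⟨ENNReal.ofReal δ, ENNReal.ofReal_pos.2 hδ, fun μ _ D hD hlt => ?_⟩
  rw [ent_mem_eq μ hD]
  refine h ?_
  rw [Real.dist_eq, sub_zero, abs_of_nonneg measureReal_nonneg]
  exact (ENNReal.lt_ofReal_iff_toReal_lt (measure_ne_top _ _)).1 hlt

/-- `H(p | B_n · α) → 0` as `n → ∞`. -/
def CondEntVanishes {J : Type*} (μ : Measure X) (T : BorelAction (FG r) X) (a : X → I)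
    (p : X → J) : Prop :=
  ∀ ε : ℝ≥0∞, 0 < ε → ∃ m, ∀ n, m ≤ n →
    ent μ (fun x => (p x, T.joinF (ball r n) a x)) ≤ ent μ (T.joinF (ball r n) a) + ε

variable {μ : Measure X} [IsProbabilityMeasure μ]

lemma CondEntVanishes.of_measurableSet (ha : Measurable a) (hgen : T.Generating a μ)
    {B : Set X} (hB : MeasurableSet B) : CondEntVanishes μ T a (fun x => x ∈ B) := by
  intro ε hε
  obtain ⟨δ, hδ, h⟩ := exists_forall_measure_lt_ent_mem_le (X := X) hε
  obtain ⟨B', ⟨m, hm⟩, hB', hlt⟩ := Generating.exists_ballSets_symmDiff_lt ha hgen hB hδ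
  refine ⟨m, fun n hn => ?_⟩
  have hD := hB'.symmDiff hB
  calc ent μ (fun x => (x ∈ B, T.joinF (ball r n) a x))
      ≤ ent μ (fun x => (T.joinF (ball r n) a x, x ∈ B' ∆ B)) := by
        refine ent_le_of_factorsThrough μ fun x y hxy => ?_
        simp only [Prod.mk.injEq] at hxy ⊢
        refine ⟨?_, hxy.1⟩
        have e : (x ∈ B') = (y ∈ B') :=
          hm (joinF_factorsThrough T (ball_mono r hn) a hxy.1)
        have e' := hxy.2
        simp only [mem_symmDiff, eq_iff_iff] at e e' ⊢
        tauto
    _ ≤ _ := ent_prod_le μ (measurable_joinF ha _) (measurableSet_setOfPred.1 hD)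
    _ ≤ _ := add_le_add_right (h μ hD hlt) _

omit [MeasurableSpace I] [MeasurableSingletonClass I] [IsProbabilityMeasure μ] in
lemma CondEntVanishes.of_factorsThrough [IsFiniteMeasure μ] {J K : Type*} [Countable J]
    {p : X → J} {q : X → K} (hp : CondEntVanishes μ T a p) (h : q.FactorsThrough p) :
    CondEntVanishes μ T a q := by
  intro ε hε
  obtain ⟨m, hm⟩ := hp ε hε
  refine ⟨m, fun n hn => (ent_le_of_factorsThrough μ fun x y hxy => ?_).trans (hm n hn)⟩
  rw [Prod.mk.injEq] at hxy ⊢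
  exact ⟨h hxy.1, hxy.2⟩

lemma CondEntVanishes.prod (hT : T.Preserves μ) (ha : Measurable a) (hent : ent μ a < ⊤)
    {J K : Type*} [Countable J] [MeasurableSpace J] [MeasurableSingletonClass J]
    [Countable K] [MeasurableSpace K] [MeasurableSingletonClass K]
    {p : X → J} {q : X → K} (hpm : Measurable p) (hqm : Measurable q)
    (hp : CondEntVanishes μ T a p) (hq : CondEntVanishes μ T a q) :
    CondEntVanishes μ T a (fun x => (p x, q x)) := by
  intro ε hε
  obtain ⟨m, hm⟩ := hp (ε / 2) (ENNReal.half_pos hε.ne')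
  obtain ⟨k, hk⟩ := hq (ε / 2) (ENNReal.half_pos hε.ne')
  refine ⟨max m k, fun n hn => ?_⟩
  have hβ := measurable_joinF (T := T) ha (ball r n)
  have hfin := ent_joinF_lt_top μ T hT ha hent (toFinite (ball r n))
  have hsub := ent_submodular μ (hpm.prodMk hβ) (hqm.prodMk hβ) hβ
    (d := fun x => ((p x, q x), T.joinF (ball r n) a x))
    (fun x y h => (Prod.mk.inj h).2) (fun x y h => (Prod.mk.inj h).2)
    (fun x y h => by simp only [Prod.mk.injEq] at h ⊢; tauto)
  have h1 := hm n ((le_max_left _ _).trans hn)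
  have h2 := hk n ((le_max_right _ _).trans hn)
  refine (ENNReal.add_le_add_iff_right hfin.ne).1 (hsub.trans ((add_le_add h1 h2).trans ?_))
  rw [add_add_add_comm, ENNReal.add_halves, add_right_comm]

lemma CondEntVanishes.of_finite (hT : T.Preserves μ) (ha : Measurable a) (hent : ent μ a < ⊤)
    (hgen : T.Generating a μ) {K : Type*} [Finite K] [MeasurableSpace K]
    [MeasurableSingletonClass K] {p : X → K} (hp : Measurable p) : CondEntVanishes μ T a p := by
  classical
  have := Fintype.ofFinite K
  have hmeas : ∀ s : Finset K, Measurable fun x => (fun k => k ∈ s ∧ p x = k : K → Prop) := by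
    intro s
    exact (measurable_of_countable fun l : K => (fun k => k ∈ s ∧ l = k : K → Prop)).comp hp
  have key : ∀ s : Finset K, CondEntVanishes μ T a
      fun x => (fun k => k ∈ s ∧ p x = k : K → Prop) := by
    intro s
    induction s using Finset.induction_on with
    | empty =>
      refine (CondEntVanishes.of_measurableSet ha hgen MeasurableSet.univ).of_factorsThrough ?_
      intro x y _
      simp
    | insert k s _ ih =>
      have hk : MeasurableSet (p ⁻¹' {k}) := hp (measurableSet_singleton k)
      refine (CondEntVanishes.prod hT ha hent (measurableSet_setOfPred.1 hk) (hmeas s)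
        (CondEntVanishes.of_measurableSet ha hgen hk) ih).of_factorsThrough ?_
      intro x y h
      rw [Prod.mk.injEq] at h
      funext l
      have h1 : (p x = k) = (p y = k) := h.1
      have h2 : (l ∈ s ∧ p x = l) = (l ∈ s ∧ p y = l) := congrFun h.2 l
      simp only [Finset.mem_insert, or_and_right, h2]
      by_cases hl : l = k
      · rw [hl, h1]
      · simp [hl]
  refine (key Finset.univ).of_factorsThrough fun x y h => ?_
  have := congrFun h (p y)
  simpa using this

end Generating

section MeanErgodic

open scoped Topology

variable {r : ℕ} {X : Type*} [mX : MeasurableSpace X] (T : BorelAction (FG r) X)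

/-- The average of the translates of a function by the free generators. -/
noncomputable def genAvg (f : X → ℝ) : X → ℝ :=
  fun x => (r : ℝ)⁻¹ * ∑ i : Fin r, f (T.act (FreeGroup.of i) x)

/-- The Cesàro averages of the iterates of `genAvg`. -/
noncomputable def cesaro (f : X → ℝ) (N : ℕ) : X → ℝ :=
  birkhoffAverage ℝ (genAvg T) id N f

lemma cesaro_apply (f : X → ℝ) (N : ℕ) (x : X) :
    cesaro T f N x = (N : ℝ)⁻¹ * ∑ n ∈ Finset.range N, (genAvg T)^[n] f x := by
  simp [cesaro, birkhoffAverage, birkhoffSum]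

variable {T}

lemma measurable_genAvg {f : X → ℝ} (hf : Measurable f) : Measurable (genAvg T f) :=
  (Finset.measurable_fun_sum _ fun _ _ => hf.comp (T.measurable_act _)).const_mul _

lemma genAvg_mem_Icc {f : X → ℝ} (hf : ∀ x, f x ∈ Icc (0 : ℝ) 1) (x : X) :
    genAvg T f x ∈ Icc (0 : ℝ) 1 := by
  refine ⟨mul_nonneg (by positivity) (Finset.sum_nonneg fun i _ => (hf _).1), ?_⟩
  have h : ∑ i : Fin r, f (T.act (FreeGroup.of i) x) ≤ r := by
    refine (Finset.sum_le_sum fun i _ => (hf _).2).trans (by simp)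
  exact (mul_le_mul_of_nonneg_left h (by positivity)).trans inv_mul_le_one

lemma measurable_iterate_genAvg {f : X → ℝ} (hf : Measurable f) (n : ℕ) :
    Measurable ((genAvg T)^[n] f) := by
  induction n with
  | zero => exact hf
  | succ n ih =>
    rw [Function.iterate_succ_apply']
    exact measurable_genAvg ih

lemma iterate_genAvg_mem_Icc {f : X → ℝ} (hf : ∀ x, f x ∈ Icc (0 : ℝ) 1) (n : ℕ) (x : X) :
    (genAvg T)^[n] f x ∈ Icc (0 : ℝ) 1 := by
  induction n generalizing x with
  | zero => exact hf x
  | succ n ih =>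
    rw [Function.iterate_succ_apply']
    exact genAvg_mem_Icc ih x

lemma measurable_cesaro {f : X → ℝ} (hf : Measurable f) (N : ℕ) : Measurable (cesaro T f N) := by
  have : cesaro T f N = fun x => (N : ℝ)⁻¹ * ∑ n ∈ Finset.range N, (genAvg T)^[n] f x :=
    funext fun x => cesaro_apply T f N x
  rw [this]
  exact (Finset.measurable_fun_sum _ fun n _ => measurable_iterate_genAvg hf n).const_mul _

lemma cesaro_mem_Icc {f : X → ℝ} (hf : ∀ x, f x ∈ Icc (0 : ℝ) 1) (N : ℕ) (x : X) :
    cesaro T f N x ∈ Icc (0 : ℝ) 1 := by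
  rw [cesaro_apply]
  refine ⟨mul_nonneg (by positivity)
    (Finset.sum_nonneg fun n _ => (iterate_genAvg_mem_Icc hf n x).1), ?_⟩
  have h : ∑ n ∈ Finset.range N, (genAvg T)^[n] f x ≤ N := by
    refine (Finset.sum_le_sum fun n _ => (iterate_genAvg_mem_Icc hf n x).2).trans (by simp)
  exact (mul_le_mul_of_nonneg_left h (by positivity)).trans inv_mul_le_one

variable {ν : Measure X} [IsProbabilityMeasure ν]

omit T in
lemma integrable_of_mem_Icc {f : X → ℝ} (hf : Measurable f) (h : ∀ x, f x ∈ Icc (0 : ℝ) 1) :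
    Integrable f ν :=
  Integrable.of_bound hf.aestronglyMeasurable 1 (ae_of_all _ fun x => by
    rw [Real.norm_eq_abs, abs_of_nonneg (h x).1]; exact (h x).2)

lemma integral_iterate_genAvg (hr : 1 ≤ r) (hν : T.Preserves ν) {f : X → ℝ} (hf : Measurable f)
    (h : ∀ x, f x ∈ Icc (0 : ℝ) 1) (n : ℕ) : ∫ x, (genAvg T)^[n] f x ∂ν = ∫ x, f x ∂ν := by
  induction n with
  | zero => rfl
  | succ n ih =>
    rw [Function.iterate_succ_apply']
    have hm := measurable_iterate_genAvg (T := T) hf n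
    have hI := iterate_genAvg_mem_Icc (T := T) h n
    have hcomp : ∀ i : Fin r, ∫ x, (genAvg T)^[n] f (T.act (FreeGroup.of i) x) ∂ν
        = ∫ x, f x ∂ν := fun i => by
      rw [← ih, ← (hν (FreeGroup.of i)).map_eq,
        integral_map (T.measurable_act _).aemeasurable hm.aestronglyMeasurable,
        (hν (FreeGroup.of i)).map_eq]
    have hr0 : (r : ℝ) ≠ 0 := by positivity
    calc ∫ x, genAvg T ((genAvg T)^[n] f) x ∂ν
        = (r : ℝ)⁻¹ * ∑ i : Fin r, ∫ x, (genAvg T)^[n] f (T.act (FreeGroup.of i) x) ∂ν := by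
          unfold genAvg
          rw [integral_const_mul, integral_finsetSum]
          exact fun i _ => integrable_of_mem_Icc (hm.comp (T.measurable_act _)) fun x => hI _
      _ = _ := by
          simp only [hcomp, Finset.sum_const, Finset.card_univ, Fintype.card_fin, nsmul_eq_mul]
          field_simp

lemma integral_cesaro (hr : 1 ≤ r) (hν : T.Preserves ν) {f : X → ℝ} (hf : Measurable f)
    (h : ∀ x, f x ∈ Icc (0 : ℝ) 1) {N : ℕ} (hN : N ≠ 0) :
    ∫ x, cesaro T f N x ∂ν = ∫ x, f x ∂ν := by
  simp_rw [cesaro_apply]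
  rw [integral_const_mul, integral_finsetSum _ fun n _ =>
    integrable_of_mem_Icc (measurable_iterate_genAvg hf n) (iterate_genAvg_mem_Icc h n)]
  simp_rw [integral_iterate_genAvg hr hν hf h]
  have : (N : ℝ) ≠ 0 := by exact_mod_cast hN
  simp only [Finset.sum_const, Finset.card_range, nsmul_eq_mul]
  field_simp

/-- The Markov operator on `L²(ν)` induced by `genAvg`. -/
noncomputable def genAvgL2 (hν : T.Preserves ν) : Lp ℝ 2 ν →L[ℝ] Lp ℝ 2 ν :=
  (r : ℝ)⁻¹ • ∑ i : Fin r,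
    (Lp.compMeasurePreservingₗᵢ ℝ (T.act (FreeGroup.of i)) (hν _)).toContinuousLinearMap

omit [IsProbabilityMeasure ν] in
lemma genAvgL2_apply (hν : T.Preserves ν) (F : Lp ℝ 2 ν) :
    genAvgL2 hν F = (r : ℝ)⁻¹ • ∑ i : Fin r,
      Lp.compMeasurePreservingₗᵢ ℝ (T.act (FreeGroup.of i)) (hν _) F := by
  simp [genAvgL2]

omit [IsProbabilityMeasure ν] in
lemma norm_genAvgL2_le (hν : T.Preserves ν) : ‖genAvgL2 hν‖ ≤ 1 := by
  refine ContinuousLinearMap.opNorm_le_bound _ zero_le_one fun F => ?_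
  rw [genAvgL2_apply, norm_smul, norm_inv, Real.norm_natCast, one_mul]
  have h : ‖∑ i : Fin r, Lp.compMeasurePreservingₗᵢ ℝ (T.act (FreeGroup.of i)) (hν _) F‖
      ≤ r * ‖F‖ := by
    refine (norm_sum_le _ _).trans ?_
    simp only [LinearIsometry.norm_map, Finset.sum_const, Finset.card_univ, Fintype.card_fin,
      nsmul_eq_mul, le_refl]
  refine (mul_le_mul_of_nonneg_left h (by positivity)).trans ?_
  rw [← mul_assoc]
  exact mul_le_of_le_one_left (norm_nonneg _) inv_mul_le_one

omit [IsProbabilityMeasure ν] in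
lemma comp_generator_eq_of_genAvgL2_eq (hr : 1 ≤ r) (hν : T.Preserves ν) {F : Lp ℝ 2 ν}
    (hF : genAvgL2 hν F = F) (i : Fin r) :
    Lp.compMeasurePreservingₗᵢ ℝ (T.act (FreeGroup.of i)) (hν _) F = F := by
  set U := fun i : Fin r => Lp.compMeasurePreservingₗᵢ ℝ (T.act (FreeGroup.of i)) (hν _) F
    with hU
  have hr0 : (r : ℝ) ≠ 0 := by positivity
  have hsum : ∑ i : Fin r, U i = (r : ℝ) • F := by
    rw [genAvgL2_apply] at hF
    conv_rhs => rw [← hF]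
    rw [smul_smul, mul_inv_cancel₀ hr0, one_smul]
  have hzero : ∑ i : Fin r, ‖U i - F‖ ^ 2 = 0 := by
    have h1 : ∀ i, ‖U i - F‖ ^ 2 = 2 * ‖F‖ ^ 2 - 2 * inner ℝ (U i) F := fun i => by
      rw [norm_sub_sq_real, hU]
      simp only [LinearIsometry.norm_map]
      ring
    simp_rw [h1]
    rw [Finset.sum_sub_distrib, ← Finset.mul_sum _ (fun i => inner ℝ (U i) F), ← sum_inner, hsum,
      real_inner_smul_left, real_inner_self_eq_norm_sq]
    simp
    ring
  have := (Finset.sum_eq_zero_iff_of_nonneg fun i _ => sq_nonneg ‖U i - F‖).1 hzero i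
    (Finset.mem_univ i)
  exact sub_eq_zero.1 (norm_eq_zero.1 (pow_eq_zero_iff two_ne_zero |>.1 this))

omit [IsProbabilityMeasure ν] in
lemma ae_eq_comp_of_forall_generator (hν : T.Preserves ν) {F : X → ℝ}
    (h : ∀ i : Fin r, (fun x => F (T.act (FreeGroup.of i) x)) =ᵐ[ν] F) (g : FG r) :
    (fun x => F (T.act g x)) =ᵐ[ν] F := by
  induction g using FreeGroup.induction_on with
  | C1 => exact ae_of_all _ fun x => by simp only [T.act_one]
  | of i => exact h i
  | inv_of i _ =>
    have := (hν (FreeGroup.of i)⁻¹).quasiMeasurePreserving.ae_eq_comp (h i)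
    filter_upwards [this] with x hx
    simpa [← T.act_mul, T.act_one] using hx.symm
  | mul g k hg hk =>
    have := (hν k).quasiMeasurePreserving.ae_eq_comp hg
    filter_upwards [this, hk] with x hx hkx
    rw [T.act_mul, ← hkx]
    exact hx

omit [IsProbabilityMeasure ν] in
lemma IsErgodic.ae_eq_const (hν : IsProbabilityMeasure ν) (herg : T.IsErgodic ν) {F : X → ℝ}
    (hF : Measurable F) (h : ∀ g : FG r, (fun x => F (T.act g x)) =ᵐ[ν] F) :
    ∃ c, F =ᵐ[ν] Function.const X c := by
  refine exists_eventuallyEq_const_of_forall_separating MeasurableSet fun U hU => ?_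
  have hB := hF hU
  have hinv : ∀ g : FG r, ν (T.smulSet g (F ⁻¹' U) ∆ (F ⁻¹' U)) = 0 := fun g => by
    refine measure_symmDiff_eq_zero_iff.2 ?_
    filter_upwards [h g⁻¹] with x hx
    change (F (T.act g⁻¹ x) ∈ U) = (F x ∈ U)
    rw [← hx]
  rcases herg _ hB hinv with h0 | h1
  · exact Or.inr (measure_eq_zero_iff_ae_notMem.1 h0)
  · exact Or.inl ((mem_ae_iff_prob_eq_one hB).2 h1)

omit [IsProbabilityMeasure ν] in
lemma genAvgL2_ae_eq (hν : T.Preserves ν) {F : Lp ℝ 2 ν} {f : X → ℝ} (h : F =ᵐ[ν] f) :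
    genAvgL2 hν F =ᵐ[ν] genAvg T f := by
  rw [genAvgL2_apply]
  have hsum : ∀ s : Finset (Fin r),
      (∑ i ∈ s, Lp.compMeasurePreservingₗᵢ ℝ (T.act (FreeGroup.of i)) (hν _) F : Lp ℝ 2 ν)
        =ᵐ[ν] fun x => ∑ i ∈ s, f (T.act (FreeGroup.of i) x) := by
    classical
    intro s
    induction s using Finset.induction_on with
    | empty =>
      simp only [Finset.sum_empty]
      exact Lp.coeFn_zero ℝ 2 ν
    | insert i s hi ih =>
      rw [Finset.sum_insert hi]
      have h1 := Lp.coeFn_compMeasurePreserving F (hν (FreeGroup.of i))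
      have h2 := (hν (FreeGroup.of i)).quasiMeasurePreserving.ae_eq_comp h
      filter_upwards [Lp.coeFn_add (Lp.compMeasurePreservingₗᵢ ℝ (T.act (FreeGroup.of i))
        (hν _) F) (∑ i ∈ s, Lp.compMeasurePreservingₗᵢ ℝ (T.act (FreeGroup.of i)) (hν _) F),
        h1, h2, ih] with x hx hx1 hx2 hx3
      rw [hx, Pi.add_apply, Finset.sum_insert hi, hx3]
      congr 1
      exact hx1.trans hx2
  filter_upwards [Lp.coeFn_smul (r : ℝ)⁻¹ (∑ i : Fin r,
    Lp.compMeasurePreservingₗᵢ ℝ (T.act (FreeGroup.of i)) (hν _) F), hsum Finset.univ]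
    with x hx hx'
  rw [hx, Pi.smul_apply, hx', smul_eq_mul, genAvg]

omit [IsProbabilityMeasure ν] in
lemma iterate_genAvgL2_ae_eq (hν : T.Preserves ν) {F : Lp ℝ 2 ν} {f : X → ℝ} (h : F =ᵐ[ν] f)
    (n : ℕ) : (genAvgL2 hν)^[n] F =ᵐ[ν] (genAvg T)^[n] f := by
  induction n with
  | zero => exact h
  | succ n ih =>
    rw [Function.iterate_succ_apply', Function.iterate_succ_apply']
    exact genAvgL2_ae_eq hν ih

omit [IsProbabilityMeasure ν] in
lemma birkhoffAverage_genAvgL2_ae_eq (hν : T.Preserves ν) {F : Lp ℝ 2 ν} {f : X → ℝ}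
    (h : F =ᵐ[ν] f) (N : ℕ) :
    (birkhoffAverage ℝ (genAvgL2 hν) id N F : Lp ℝ 2 ν) =ᵐ[ν] cesaro T f N := by
  have hsum : ∀ N : ℕ, (birkhoffSum (genAvgL2 hν) id N F : Lp ℝ 2 ν)
      =ᵐ[ν] fun x => ∑ n ∈ Finset.range N, (genAvg T)^[n] f x := by
    intro N
    induction N with
    | zero =>
      simp only [birkhoffSum_zero, Finset.range_zero, Finset.sum_empty]
      exact Lp.coeFn_zero ℝ 2 ν
    | succ N ih =>
      rw [birkhoffSum_succ]
      filter_upwards [Lp.coeFn_add (birkhoffSum (genAvgL2 hν) id N F)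
        (id ((genAvgL2 hν)^[N] F)), ih, iterate_genAvgL2_ae_eq hν h N] with x hx hx1 hx2
      rw [hx, Pi.add_apply, Finset.sum_range_succ, hx1, id, hx2]
  unfold birkhoffAverage
  filter_upwards [Lp.coeFn_smul (N : ℝ)⁻¹ (birkhoffSum (genAvgL2 hν) id N F), hsum N]
    with x hx hx'
  rw [hx, Pi.smul_apply, hx', smul_eq_mul, cesaro_apply]

omit T [IsProbabilityMeasure ν] in
lemma norm_sq_eq_integral_of_ae_eq {F : Lp ℝ 2 ν} {f : X → ℝ} (h : F =ᵐ[ν] f) :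
    ‖F‖ ^ 2 = ∫ x, f x ^ 2 ∂ν := by
  rw [← real_inner_self_eq_norm_sq, L2.inner_def]
  refine integral_congr_ae ?_
  filter_upwards [h] with x hx
  rw [hx, real_inner_self_eq_norm_sq, Real.norm_eq_abs, sq_abs]

/-- Mean ergodic theorem: for an ergodic measure, the second moments of the Cesàro averages of a
function converge to the square of its mean. -/
lemma tendsto_integral_cesaro_sq (hr : 1 ≤ r) (hν : T.Preserves ν) (herg : T.IsErgodic ν)
    {f : X → ℝ} (hf : Measurable f) (hI : ∀ x, f x ∈ Icc (0 : ℝ) 1) :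
    Tendsto (fun N => ∫ x, cesaro T f N x ^ 2 ∂ν) atTop (𝓝 ((∫ x, f x ∂ν) ^ 2)) := by
  have hmem : MemLp f 2 ν := MemLp.of_bound hf.aestronglyMeasurable 1 (ae_of_all _ fun x => by
    rw [Real.norm_eq_abs, abs_of_nonneg (hI x).1]; exact (hI x).2)
  set F := hmem.toLp f with hFdef
  have hF : F =ᵐ[ν] f := hmem.coeFn_toLp
  have hlim := (genAvgL2 hν).tendsto_birkhoffAverage_orthogonalProjection (norm_genAvgL2_le hν) F
  set S := (genAvgL2 hν).eqLocus (1 : Lp ℝ 2 ν →L[ℝ] Lp ℝ 2 ν) with hS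
  set Q : Lp ℝ 2 ν := (S.orthogonalProjectionOnto F).1 with hQ
  have hQfix : genAvgL2 hν Q = Q := (S.orthogonalProjectionOnto F).2
  have hQgen : ∀ i : Fin r, (fun x => Q (T.act (FreeGroup.of i) x)) =ᵐ[ν] Q := fun i => by
    have h1 := Lp.coeFn_compMeasurePreserving Q (hν (FreeGroup.of i))
    have h2 := comp_generator_eq_of_genAvgL2_eq hr hν hQfix i
    have h3 : ⇑(Lp.compMeasurePreservingₗᵢ ℝ (T.act (FreeGroup.of i)) (hν _) Q)
        =ᵐ[ν] Q ∘ T.act (FreeGroup.of i) := h1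
    rw [h2] at h3
    exact h3.symm
  obtain ⟨c, hc⟩ := IsErgodic.ae_eq_const inferInstance herg (Lp.stronglyMeasurable Q).measurable
    (ae_eq_comp_of_forall_generator hν hQgen)
  have hnorm : Tendsto (fun N => ∫ x, cesaro T f N x ^ 2 ∂ν) atTop (𝓝 (‖Q‖ ^ 2)) := by
    refine (hlim.norm.pow 2).congr fun N => ?_
    exact norm_sq_eq_integral_of_ae_eq (birkhoffAverage_genAvgL2_ae_eq hν hF N)
  have hQn : ‖Q‖ ^ 2 = c ^ 2 := by
    rw [norm_sq_eq_integral_of_ae_eq hc]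
    simp
  have hcI : c = ∫ x, f x ∂ν := by
    have hone : MemLp (fun _ : X => (1 : ℝ)) 2 ν := memLp_const 1
    have hinner : ∀ {G : Lp ℝ 2 ν} {g : X → ℝ}, G =ᵐ[ν] g →
        inner ℝ (hone.toLp _) G = ∫ x, g x ∂ν := fun {G g} hG => by
      rw [L2.inner_def]
      refine integral_congr_ae ?_
      filter_upwards [hG, hone.coeFn_toLp] with x hx hx1
      rw [hx, hx1]
      simp
    have hQc : inner ℝ (hone.toLp _) Q = c := by
      rw [hinner hc]
      simp
    have hl : Tendsto (fun N => inner ℝ (hone.toLp _)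
        (birkhoffAverage ℝ (genAvgL2 hν) id N F)) atTop (𝓝 (inner ℝ (hone.toLp _) Q)) :=
      tendsto_const_nhds.inner hlim
    rw [hQc] at hl
    refine tendsto_nhds_unique hl (tendsto_const_nhds.congr' ?_)
    filter_upwards [eventually_ne_atTop 0] with N hN
    rw [hinner (birkhoffAverage_genAvgL2_ae_eq hν hF N), integral_cesaro hr hν hf hI hN]
  rw [hQn, hcI] at hnorm
  exact hnorm

end MeanErgodic

section Lifting

open scoped Topology

variable {r : ℕ} {X : Type*} [mX : MeasurableSpace X] {T : BorelAction (FG r) X}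
  {τ : Measure (Measure X)} [IsProbabilityMeasure τ]

lemma ae_of_measure_eq_one_of_subset {M : Type*} [MeasurableSpace M] {τ : Measure M}
    [IsProbabilityMeasure τ] {s t : Set M} (hs : τ s = 1) (ht : MeasurableSet t) (h : s ⊆ t) :
    ∀ᵐ m ∂τ, m ∈ t :=
  (mem_ae_iff_prob_eq_one ht).2 (le_antisymm prob_le_one (hs ▸ measure_mono h))

lemma exists_countable_piSystem (X : Type*) [mX : MeasurableSpace X]
    [MeasurableSpace.CountablyGenerated X] :
    ∃ C : Set (Set X), C.Countable ∧ mX = MeasurableSpace.generateFrom C ∧ IsPiSystem C := by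
  refine ⟨generateSetAlgebra (MeasurableSpace.countableGeneratingSet X),
    countable_generateSetAlgebra MeasurableSpace.countable_countableGeneratingSet, ?_, ?_⟩
  · rw [generateFrom_generateSetAlgebra_eq, MeasurableSpace.generateFrom_countableGeneratingSet]
  · exact fun s hs t ht _ => isSetAlgebra_generateSetAlgebra.inter_mem hs ht

lemma ae_mem_InvProb [MeasurableSpace.CountablyGenerated X] (hconc : τ (InvProb T) = 1) :
    ∀ᵐ ν ∂τ, ν ∈ InvProb T := by
  obtain ⟨C, hCc, hCg, hCp⟩ := exists_countable_piSystem X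
  have hCm : ∀ B ∈ C, MeasurableSet B := fun B hB => by
    rw [hCg]; exact MeasurableSpace.measurableSet_generateFrom hB
  have hprob : ∀ᵐ ν ∂τ, ν univ = 1 := by
    refine ae_of_measure_eq_one_of_subset (t := {ν | ν univ = 1}) hconc ?_ fun ν hν => ?_
    · exact measurableSet_eq_fun (Measure.measurable_coe MeasurableSet.univ) measurable_const
    · exact hν.1.measure_univ
  have hinv : ∀ᵐ ν ∂τ, ∀ g : FG r, ∀ B ∈ C, ν (T.act g ⁻¹' B) = ν B := by
    rw [ae_all_iff]
    intro g
    rw [ae_ball_iff hCc]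
    intro B hB
    refine ae_of_measure_eq_one_of_subset (t := {ν | ν (T.act g ⁻¹' B) = ν B}) hconc ?_ ?_
    · exact measurableSet_eq_fun (Measure.measurable_coe (T.measurable_act g (hCm B hB)))
        (Measure.measurable_coe (hCm B hB))
    · exact fun ν hν => (hν.2 g).measure_preimage (hCm B hB).nullMeasurableSet
  filter_upwards [hprob, hinv] with ν h1 h2
  have hν : IsProbabilityMeasure ν := ⟨h1⟩
  refine ⟨hν, fun g => ⟨T.measurable_act g, ?_⟩⟩
  have : IsProbabilityMeasure (ν.map (T.act g)) :=
    Measure.isProbabilityMeasure_map (T.measurable_act g).aemeasurable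
  refine ext_of_generate_finite C hCg hCp (fun B hB => ?_) (by simp)
  rw [Measure.map_apply (T.measurable_act g) (hCm B hB), h2 g B hB]

lemma ae_of_forall_isErgodic [MeasurableSpace.CountablyGenerated X] (hconc : τ (InvProb T) = 1)
    (hergm : τ {ν | T.IsErgodic ν} = 1) {P : Set (Measure X)} (hP : MeasurableSet P)
    (h : ∀ ν ∈ InvProb T, T.IsErgodic ν → ν ∈ P) : ∀ᵐ ν ∂τ, ν ∈ P := by
  refine (mem_ae_iff_prob_eq_one hP).2 (le_antisymm prob_le_one ?_)
  calc 1 = τ {ν | T.IsErgodic ν} := hergm.symm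
    _ ≤ τ P := measure_mono_ae <| by
      filter_upwards [ae_mem_InvProb hconc] with ν hν hE using h ν hν hE

/-- The Cesàro averages of the indicator function of a set. -/
noncomputable def visits (T : BorelAction (FG r) X) (B : Set X) (N : ℕ) : X → ℝ :=
  cesaro T (B.indicator 1) N

omit mX in
lemma indicator_one_mem_Icc (B : Set X) (x : X) : B.indicator (1 : X → ℝ) x ∈ Icc (0 : ℝ) 1 := by
  by_cases hx : x ∈ B <;> simp [hx]

lemma measurable_visits {B : Set X} (hB : MeasurableSet B) (N : ℕ) :
    Measurable (visits T B N) :=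
  measurable_cesaro (measurable_one.indicator hB) N

lemma visits_mem_Icc (B : Set X) (N : ℕ) (x : X) : visits T B N x ∈ Icc (0 : ℝ) 1 :=
  cesaro_mem_Icc (indicator_one_mem_Icc B) N x

/-- The second moment of the visit frequency. -/
noncomputable def visitsMoment (T : BorelAction (FG r) X) (B : Set X) (N : ℕ) (ν : Measure X) :
    ℝ≥0∞ := ∫⁻ x, ENNReal.ofReal (visits T B N x ^ 2) ∂ν

lemma measurable_visitsMoment {B : Set X} (hB : MeasurableSet B) (N : ℕ) :
    Measurable (visitsMoment T B N) :=
  Measure.measurable_lintegral ((measurable_visits hB N).pow_const 2).ennreal_ofReal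

lemma integrable_visits_sq {B : Set X} (hB : MeasurableSet B) (N : ℕ) (ν : Measure X)
    [IsProbabilityMeasure ν] : Integrable (fun x => visits T B N x ^ 2) ν :=
  integrable_of_mem_Icc ((measurable_visits hB N).pow_const 2) fun x =>
    ⟨sq_nonneg _, pow_le_one₀ (visits_mem_Icc B N x).1 (visits_mem_Icc B N x).2⟩

lemma visitsMoment_eq_ofReal {B : Set X} (hB : MeasurableSet B) (N : ℕ) (ν : Measure X)
    [IsProbabilityMeasure ν] :
    visitsMoment T B N ν = ENNReal.ofReal (∫ x, visits T B N x ^ 2 ∂ν) :=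
  (ofReal_integral_eq_lintegral_ofReal (integrable_visits_sq hB N ν)
    (ae_of_all _ fun _ => sq_nonneg _)).symm

lemma visitsMoment_le_one {B : Set X} (N : ℕ) (ν : Measure X)
    [IsProbabilityMeasure ν] : visitsMoment T B N ν ≤ 1 := by
  calc visitsMoment T B N ν ≤ ∫⁻ _, 1 ∂ν := lintegral_mono fun x => by
        rw [← ENNReal.ofReal_one]
        exact ENNReal.ofReal_le_ofReal
          (pow_le_one₀ (visits_mem_Icc B N x).1 (visits_mem_Icc B N x).2)
    _ = 1 := by simp

lemma integral_visits (hr : 1 ≤ r) {ν : Measure X} [IsProbabilityMeasure ν] (hν : T.Preserves ν)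
    {B : Set X} (hB : MeasurableSet B) {N : ℕ} (hN : N ≠ 0) :
    ∫ x, visits T B N x ∂ν = ν.real B := by
  rw [visits, integral_cesaro hr hν (measurable_one.indicator hB) (indicator_one_mem_Icc B) hN]
  simp [integral_indicator hB]

lemma lintegral_visits_sub_sq (hr : 1 ≤ r) {ν : Measure X} [IsProbabilityMeasure ν]
    (hν : T.Preserves ν) {B : Set X} (hB : MeasurableSet B) {N : ℕ} (hN : N ≠ 0) :
    ∫⁻ x, ENNReal.ofReal ((visits T B N x - ν.real B) ^ 2) ∂ν
      = visitsMoment T B N ν - (ν B) ^ 2 := by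
  have hi : Integrable (visits T B N) ν :=
    integrable_of_mem_Icc (measurable_visits hB N) (visits_mem_Icc B N)
  have hsq := integrable_visits_sq (T := T) hB N ν
  have heq : ∀ x, (visits T B N x - ν.real B) ^ 2
      = visits T B N x ^ 2 - 2 * ν.real B * visits T B N x + ν.real B ^ 2 := fun x => by ring
  have hsub : Integrable (fun x => visits T B N x ^ 2 - 2 * ν.real B * visits T B N x) ν :=
    hsq.sub (hi.const_mul _)
  have hint : ∫ x, (visits T B N x - ν.real B) ^ 2 ∂ν
      = ∫ x, visits T B N x ^ 2 ∂ν - ν.real B ^ 2 := by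
    simp_rw [heq]
    rw [integral_add hsub (integrable_const _), integral_sub hsq (hi.const_mul _), integral_const_mul,
      integral_visits hr hν hB hN]
    simp
    ring
  have hib : Integrable (fun x => (visits T B N x - ν.real B) ^ 2) ν := by
    simp_rw [heq]
    exact hsub.add (integrable_const _)
  rw [← ofReal_integral_eq_lintegral_ofReal hib (ae_of_all _ fun _ => sq_nonneg _), hint,
    ENNReal.ofReal_sub _ (by positivity), visitsMoment_eq_ofReal hB,
    ENNReal.ofReal_pow measureReal_nonneg, ofReal_measureReal]

lemma ae_tendsto_visitsMoment [MeasurableSpace.CountablyGenerated X] (hr : 1 ≤ r)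
    (hconc : τ (InvProb T) = 1) (hergm : τ {ν | T.IsErgodic ν} = 1) {B : Set X}
    (hB : MeasurableSet B) :
    ∀ᵐ ν ∂τ, Tendsto (fun N => visitsMoment T B N ν) atTop (𝓝 ((ν B) ^ 2)) := by
  refine ae_of_forall_isErgodic hconc hergm (measurableSet_tendsto_fun
    (measurable_visitsMoment hB) ((Measure.measurable_coe hB).pow_const 2)) fun ν hν herg => ?_
  have := hν.1
  have h := tendsto_integral_cesaro_sq hr hν.2 herg (measurable_one.indicator hB)
    (indicator_one_mem_Icc B)
  have h2 := ENNReal.tendsto_ofReal h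
  have h3 : ENNReal.ofReal ((∫ x, B.indicator (1 : X → ℝ) x ∂ν) ^ 2) = (ν B) ^ 2 := by
    rw [show ∫ x, B.indicator (1 : X → ℝ) x ∂ν = ν.real B by simp [integral_indicator hB],
      ENNReal.ofReal_pow measureReal_nonneg, ofReal_measureReal]
  rw [h3] at h2
  exact h2.congr fun N => (visitsMoment_eq_ofReal hB N ν).symm

/-- The value `ν B` can be read off from almost every point, for almost every ergodic
component `ν`. -/
lemma exists_measurable_eq_measure [MeasurableSpace.CountablyGenerated X] (hr : 1 ≤ r)
    (hconc : τ (InvProb T) = 1) (hergm : τ {ν | T.IsErgodic ν} = 1) {B : Set X}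
    (hB : MeasurableSet B) :
    ∃ f : X → ℝ≥0∞, Measurable f ∧ ∀ᵐ ν ∂τ, ∀ᵐ x ∂ν, f x = ν B := by
  set W : ℕ → Measure X → ℝ≥0∞ := fun N ν => visitsMoment T B N ν - (ν B) ^ 2 with hW
  have hWm : ∀ N, Measurable (W N) := fun N =>
    (measurable_visitsMoment hB N).sub ((Measure.measurable_coe hB).pow_const 2)
  have hInv := ae_mem_InvProb hconc
  have hlim : Tendsto (fun N => ∫⁻ ν, W N ν ∂τ) atTop (𝓝 (∫⁻ _, 0 ∂τ)) := by
    refine tendsto_lintegral_of_dominated_convergence (fun _ => 1) hWm (fun N => ?_) (by simp) ?_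
    · filter_upwards [hInv] with ν hν
      have := hν.1
      exact tsub_le_self.trans (visitsMoment_le_one N ν)
    · filter_upwards [hInv, ae_tendsto_visitsMoment hr hconc hergm hB] with ν hν h
      have := hν.1
      have h2 := ENNReal.Tendsto.sub h (tendsto_const_nhds (x := (ν B) ^ 2))
        (Or.inr (ENNReal.pow_ne_top (measure_ne_top _ _)))
      simpa using h2
  rw [lintegral_zero] at hlim
  have hchoose : ∀ k : ℕ, ∃ N, N ≠ 0 ∧ ∫⁻ ν, W N ν ∂τ ≤ (2⁻¹ : ℝ≥0∞) ^ k := fun k => by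
    have hpos : (0 : ℝ≥0∞) < 2⁻¹ ^ k := ENNReal.pow_pos (by simp) k
    obtain ⟨N, hN, hN0⟩ := ((hlim.eventually (ge_mem_nhds hpos)).and (eventually_ne_atTop 0)).exists
    exact ⟨N, hN0, hN⟩
  choose N hN0 hN using hchoose
  have hsum : ∀ᵐ ν ∂τ, ∑' k, W (N k) ν < ⊤ := by
    refine ae_lt_top (Measurable.tsum fun k => hWm _) 
      (ne_top_of_le_ne_top (b := ∑' k : ℕ, (2⁻¹ : ℝ≥0∞) ^ k) ?_ ?_)
    · rw [ENNReal.tsum_geometric]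
      simp
    · rw [lintegral_tsum fun k => (hWm _).aemeasurable]
      exact ENNReal.tsum_le_tsum hN
  refine ⟨fun x => limsup (fun k => ENNReal.ofReal (visits T B (N k) x)) atTop,
    Measurable.limsup fun k => (measurable_visits hB _).ennreal_ofReal, ?_⟩
  filter_upwards [hInv, hsum] with ν hν hs
  have := hν.1
  have hm : ∀ k, Measurable fun x => ENNReal.ofReal ((visits T B (N k) x - ν.real B) ^ 2) :=
    fun k => (((measurable_visits hB _).sub_const _).pow_const 2).ennreal_ofReal
  have hfin : ∀ᵐ x ∂ν, ∑' k, ENNReal.ofReal ((visits T B (N k) x - ν.real B) ^ 2) < ⊤ := by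
    refine ae_lt_top (Measurable.tsum hm) ?_
    rw [lintegral_tsum fun k => (hm k).aemeasurable]
    simp_rw [lintegral_visits_sub_sq hr hν.2 hB (hN0 _)]
    exact hs.ne
  filter_upwards [hfin] with x hx
  have h0 := ENNReal.tendsto_atTop_zero_of_tsum_ne_top hx.ne
  have h1 : Tendsto (fun k => (visits T B (N k) x - ν.real B) ^ 2) atTop (𝓝 0) := by
    have := (ENNReal.tendsto_toReal (a := 0) (by simp)).comp h0
    refine this.congr fun k => ?_
    rw [Function.comp_apply, ENNReal.toReal_ofReal (sq_nonneg _)]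
  have h2 : Tendsto (fun k => visits T B (N k) x - ν.real B) atTop (𝓝 0) := by
    have := (Real.continuous_sqrt.tendsto 0).comp h1
    rw [Real.sqrt_zero] at this
    refine (tendsto_zero_iff_abs_tendsto_zero _).2 (this.congr fun k => ?_)
    rw [Function.comp_apply, Function.comp_apply, Real.sqrt_sq_eq_abs]
  have h3 : Tendsto (fun k => visits T B (N k) x) atTop (𝓝 (ν.real B)) := by
    simpa using h2.add_const (ν.real B)
  rw [(ENNReal.tendsto_ofReal h3).limsup_eq, ofReal_measureReal]

/-- A decomposition `μ = ∫ ν dτ(ν)` into invariant probability measures such that every measurable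
set of components is, up to null sets, visible as a measurable subset of the space. -/
structure Decomposes (T : BorelAction (FG r) X) (μ : Measure X) (τ : Measure (Measure X)) :
    Prop where
  inv : ∀ᵐ ν ∂τ, ν ∈ InvProb T
  dec : ∀ B : Set X, MeasurableSet B → μ B = ∫⁻ ν, ν B ∂τ
  lift : ∀ P : Set (Measure X), MeasurableSet P →
    ∃ B : Set X, MeasurableSet B ∧ ∀ᵐ ν ∂τ, ∀ᵐ x ∂ν, (x ∈ B ↔ ν ∈ P)

lemma decomposes_of_ergodic [MeasurableSpace.CountablyGenerated X] (hr : 1 ≤ r)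
    (hconc : τ (InvProb T) = 1) (hergm : τ {ν | T.IsErgodic ν} = 1) {μ : Measure X}
    (hdec : ∀ B : Set X, MeasurableSet B → μ B = ∫⁻ ν, ν B ∂τ) : Decomposes T μ τ := by
  refine ⟨ae_mem_InvProb hconc, hdec, ?_⟩
  let m : MeasurableSpace (Measure X) :=
    { MeasurableSet' := fun P => ∃ B : Set X, MeasurableSet B ∧ ∀ᵐ ν ∂τ, ∀ᵐ x ∂ν, (x ∈ B ↔ ν ∈ P)
      measurableSet_empty := ⟨∅, MeasurableSet.empty, by simp⟩
      measurableSet_compl := by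
        rintro P ⟨B, hB, h⟩
        refine ⟨Bᶜ, hB.compl, ?_⟩
        filter_upwards [h] with ν hν
        filter_upwards [hν] with x hx
        exact not_congr hx
      measurableSet_iUnion := by
        intro P hP
        choose B hB h using hP
        refine ⟨⋃ i, B i, MeasurableSet.iUnion hB, ?_⟩
        filter_upwards [ae_all_iff.2 h] with ν hν
        filter_upwards [ae_all_iff.2 hν] with x hx
        simp only [mem_iUnion]
        exact exists_congr hx }
  have hle : Measure.instMeasurableSpace ≤ m := by
    refine iSup₂_le fun B hB => ?_
    rintro _ ⟨C, hC, rfl⟩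
    obtain ⟨f, hf, h⟩ := exists_measurable_eq_measure hr hconc hergm hB
    refine ⟨f ⁻¹' C, hf hC, ?_⟩
    filter_upwards [h] with ν hν
    filter_upwards [hν] with x hx
    rw [mem_preimage, hx, mem_preimage]
  exact fun P hP => hle P hP

variable {μ : Measure X}

omit [IsProbabilityMeasure τ] in
lemma Decomposes.ae_ae (h : Decomposes T μ τ) {P : X → Prop} (hP : ∀ᵐ x ∂μ, P x) :
    ∀ᵐ ν ∂τ, ∀ᵐ x ∂ν, P x := by
  obtain ⟨s, hsub, hs, hs0⟩ := exists_measurable_superset_of_null hP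
  rw [h.dec s hs, lintegral_eq_zero_iff (Measure.measurable_coe hs)] at hs0
  filter_upwards [hs0] with ν hν
  exact measure_mono_null hsub hν

omit [IsProbabilityMeasure τ] in
lemma Decomposes.ae_of_ae_ae (h : Decomposes T μ τ) {P : X → Prop} (hP : MeasurableSet {x | P x})
    (hae : ∀ᵐ ν ∂τ, ∀ᵐ x ∂ν, P x) : ∀ᵐ x ∂μ, P x := by
  rw [ae_iff]
  change μ {x | P x}ᶜ = 0
  rw [h.dec _ hP.compl, lintegral_eq_zero_iff (Measure.measurable_coe hP.compl)]
  filter_upwards [hae] with ν hν using hν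

/-- The function `p` on the space represents the function `q` on the set of components. -/
def Represents {K : Type*} (τ : Measure (Measure X)) (p : X → K) (q : Measure X → K) : Prop :=
  ∀ᵐ ν ∂τ, ∀ᵐ x ∂ν, p x = q ν

omit [IsProbabilityMeasure τ] in
lemma Decomposes.exists_represents (h : Decomposes T μ τ) {K : Type*} [Finite K] [Nonempty K]
    [MeasurableSpace K] [MeasurableSingletonClass K] {q : Measure X → K} (hq : Measurable q) :
    ∃ p : X → K, Measurable p ∧ Represents τ p q := by
  classical
  choose B hB hBq using fun k : K => h.lift (q ⁻¹' {k}) (hq (measurableSet_singleton k))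
  let φ : (K → Prop) → K := fun s =>
    if hs : ∃ k, s = (fun j => j = k) then hs.choose else Classical.arbitrary K
  have hφ : ∀ k, φ (fun j => j = k) = k := fun k => by
    have hs : ∃ k', (fun j => j = k) = (fun j : K => j = k') := ⟨k, rfl⟩
    have h2 := congrFun hs.choose_spec k
    simp only [φ, dif_pos hs]
    exact (h2.mp rfl).symm
  have hm : Measurable fun x k => x ∈ B k :=
    measurable_pi_lambda _ fun k => measurable_mem.2 (hB k)
  refine ⟨fun x => φ fun k => x ∈ B k, (Measurable.of_discrete (f := φ)).comp hm, ?_⟩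
  · filter_upwards [ae_all_iff.2 hBq] with ν hν
    filter_upwards [ae_all_iff.2 hν] with x hx
    have : (fun k => x ∈ B k) = fun j => j = q ν := by
      ext k
      rw [hx k]
      exact eq_comm
    change φ (fun k => x ∈ B k) = q ν
    rw [this, hφ]

omit [IsProbabilityMeasure τ] in
lemma Represents.comp_act_ae_eq (h : Decomposes T μ τ) {K : Type*} [Countable K]
    [MeasurableSpace K] [MeasurableSingletonClass K] {p : X → K} {q : Measure X → K}
    (hp : Measurable p) (hpq : Represents τ p q) (g : FG r) :
    (fun x => p (T.act g x)) =ᵐ[μ] p := by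
  refine h.ae_of_ae_ae (measurableSet_eq_fun (hp.comp (T.measurable_act g)) hp) ?_
  filter_upwards [h.inv, hpq] with ν hν h1
  filter_upwards [h1, (hν.2 g).quasiMeasurePreserving.ae h1] with x hx hx2
  rw [hx, hx2]

omit [IsProbabilityMeasure τ] in
lemma Represents.measure_inter_eq (h : Decomposes T μ τ) {K : Type*} [MeasurableSpace K]
    [MeasurableSingletonClass K] {p : X → K} {q : Measure X → K} (hp : Measurable p)
    (hq : Measurable q) (hpq : Represents τ p q) {C : Set X} (hC : MeasurableSet C) (k : K) :
    μ (C ∩ p ⁻¹' {k}) = ∫⁻ ν in q ⁻¹' {k}, ν C ∂τ := by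
  rw [h.dec _ (hC.inter (hp (measurableSet_singleton k))),
    ← lintegral_indicator (hq (measurableSet_singleton k))]
  refine lintegral_congr_ae ?_
  filter_upwards [hpq] with ν hν
  by_cases hk : q ν = k
  · rw [indicator_of_mem (by simpa using hk)]
    refine measure_congr ?_
    filter_upwards [hν] with x hx
    change (x ∈ C ∧ p x = k) = (x ∈ C)
    rw [hx, hk]
    simp
  · rw [indicator_of_notMem (by simpa using hk)]
    rw [measure_eq_zero_iff_ae_notMem]
    filter_upwards [hν] with x hx hmem
    exact hk (hx.symm.trans hmem.2)

end Lifting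

section CellEstimates

variable {M : Type*} [MeasurableSpace M] {τ : Measure M} [IsFiniteMeasure τ]

lemma negMulLog_eq_add {m t : ℝ} (ht : t ≠ 0) :
    Real.negMulLog m = m / t * Real.negMulLog t + t * Real.negMulLog (m / t) := by
  conv_lhs => rw [← mul_div_cancel₀ m ht]
  rw [Real.negMulLog_mul]

variable {u : M → ℝ} (hu : Measurable u) (hu1 : ∀ᵐ x ∂τ, u x ∈ Icc (0 : ℝ) 1)
include hu hu1

lemma integrable_of_ae_mem_Icc : Integrable u τ :=
  Integrable.of_bound hu.aestronglyMeasurable 1 (by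
    filter_upwards [hu1] with x hx
    rw [Real.norm_eq_abs, abs_of_nonneg hx.1]; exact hx.2)

lemma integrable_negMulLog_of_ae_mem_Icc : Integrable (fun x => Real.negMulLog (u x)) τ :=
  integrable_of_ae_mem_Icc (Real.continuous_negMulLog.measurable.comp hu) (by
    filter_upwards [hu1] with x hx
    refine ⟨Real.negMulLog_nonneg hx.1 hx.2, ?_⟩
    rcases hx.1.eq_or_lt with h | h
    · simp [← h]
    · have := Real.one_sub_inv_le_log_of_pos h
      have h2 : u x * (1 - (u x)⁻¹) ≤ u x * Real.log (u x) := mul_le_mul_of_nonneg_left this h.le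
      rw [mul_sub, mul_inv_cancel₀ h.ne'] at h2
      rw [Real.negMulLog]
      linarith)

lemma setIntegral_negMulLog_le {S : Set M} (hS : τ S ≠ 0) :
    ∫ x in S, Real.negMulLog (u x) ∂τ
      ≤ τ.real S * Real.negMulLog ((∫ x in S, u x ∂τ) / τ.real S) := by
  have ht : 0 < τ.real S := ENNReal.toReal_pos hS (measure_ne_top _ _)
  have h := Real.concaveOn_negMulLog.le_map_set_average (μ := τ) (t := S) (f := u)
    Real.continuous_negMulLog.continuousOn isClosed_Ici hS (measure_ne_top _ _)
    (ae_restrict_of_ae (hu1.mono fun x hx => hx.1))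
    (integrable_of_ae_mem_Icc hu hu1).integrableOn
    (integrable_negMulLog_of_ae_mem_Icc hu hu1).integrableOn
  rw [setAverage_eq, setAverage_eq, smul_eq_mul, smul_eq_mul, inv_mul_le_iff₀ ht,
    inv_mul_eq_div] at h
  exact h

lemma le_setIntegral_negMulLog_add {S : Set M} (hSm : MeasurableSet S) (hS : τ S ≠ 0)
    {δ ε : ℝ} (hδ : ∀ x ∈ S, ∀ y ∈ S, |u x - u y| ≤ δ)
    (hε : ∀ s ∈ Icc (0 : ℝ) 1, ∀ t ∈ Icc (0 : ℝ) 1, |s - t| ≤ δ →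
      |Real.negMulLog s - Real.negMulLog t| ≤ ε) :
    τ.real S * Real.negMulLog ((∫ x in S, u x ∂τ) / τ.real S)
      ≤ ∫ x in S, Real.negMulLog (u x) ∂τ + ε * τ.real S := by
  have ht : 0 < τ.real S := ENNReal.toReal_pos hS (measure_ne_top _ _)
  have hi := (integrable_of_ae_mem_Icc hu hu1).integrableOn (s := S)
  have hi2 := (integrable_negMulLog_of_ae_mem_Icc hu hu1).integrableOn (s := S)
  set c := (∫ x in S, u x ∂τ) / τ.real S with hc
  have hc01 : c ∈ Icc (0 : ℝ) 1 := by
    refine ⟨div_nonneg (integral_nonneg_of_ae (ae_restrict_of_ae (hu1.mono fun x hx => hx.1)))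
      ht.le, (div_le_one ht).2 ?_⟩
    calc ∫ x in S, u x ∂τ ≤ ∫ _ in S, (1 : ℝ) ∂τ :=
          integral_mono_ae hi (integrable_const _) (ae_restrict_of_ae (hu1.mono fun x hx => hx.2))
      _ = τ.real S := by simp
  have hclose : ∀ x ∈ S, |c - u x| ≤ δ := fun x hx => by
    have h1 : ∫ y in S, u y ∂τ ≤ ∫ _ in S, (u x + δ) ∂τ :=
      setIntegral_mono_on hi (integrable_const _) hSm fun y hy => by
        linarith [(abs_le.1 (hδ x hx y hy)).1]
    have h2 : ∫ _ in S, (u x - δ) ∂τ ≤ ∫ y in S, u y ∂τ :=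
      setIntegral_mono_on (integrable_const _) hi hSm fun y hy => by
        linarith [(abs_le.1 (hδ x hx y hy)).2]
    rw [setIntegral_const, smul_eq_mul] at h1 h2
    rw [abs_le]
    constructor
    · have : u x - δ ≤ c := (le_div_iff₀' ht).2 h2
      linarith
    · have : c ≤ u x + δ := (div_le_iff₀' ht).2 h1
      linarith
  calc τ.real S * Real.negMulLog c = ∫ _ in S, Real.negMulLog c ∂τ := by simp
    _ ≤ ∫ x in S, (Real.negMulLog (u x) + ε) ∂τ := by
        refine integral_mono_ae (integrable_const _) (hi2.add (integrable_const _)) ?_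
        filter_upwards [ae_restrict_of_ae hu1, ae_restrict_mem hSm] with x hx hxS
        linarith [(abs_le.1 (hε c hc01 (u x) hx (hclose x hxS))).2]
    _ = _ := by
        rw [integral_add hi2 (integrable_const _)]
        simp [mul_comm]

end CellEstimates

section CellEstimatesENNReal

variable {M : Type*} [MeasurableSpace M] {τ : Measure M} [IsProbabilityMeasure τ]
  {u : M → ℝ≥0∞} (hu : Measurable u) (hu1 : ∀ᵐ x ∂τ, u x ≤ 1)

omit [IsProbabilityMeasure τ] in
include hu1 in
lemma ae_toReal_mem_Icc : ∀ᵐ x ∂τ, (u x).toReal ∈ Icc (0 : ℝ) 1 := by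
  filter_upwards [hu1] with x hx
  exact ⟨ENNReal.toReal_nonneg, ENNReal.toReal_le_of_le_ofReal zero_le_one (by simpa using hx)⟩

include hu hu1

omit [IsProbabilityMeasure τ] in
lemma integral_toReal_of_le_one (S : Set M) :
    ∫ x in S, (u x).toReal ∂τ = (∫⁻ x in S, u x ∂τ).toReal :=
  integral_toReal hu.aemeasurable
    (ae_restrict_of_ae (hu1.mono fun _ hx => hx.trans_lt ENNReal.one_lt_top))

lemma lintegral_ofReal_negMulLog (S : Set M) :
    ∫⁻ x in S, ENNReal.ofReal (Real.negMulLog (u x).toReal) ∂τ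
      = ENNReal.ofReal (∫ x in S, Real.negMulLog (u x).toReal ∂τ) := by
  refine (ofReal_integral_eq_lintegral_ofReal (integrable_negMulLog_of_ae_mem_Icc
    hu.ennreal_toReal (ae_toReal_mem_Icc hu1)).integrableOn ?_).symm
  refine ae_restrict_of_ae ((ae_toReal_mem_Icc hu1).mono fun x hx => ?_)
  exact Real.negMulLog_nonneg hx.1 hx.2

omit hu [IsProbabilityMeasure τ] in
lemma lintegral_le_measure_of_le_one (S : Set M) : ∫⁻ x in S, u x ∂τ ≤ τ S :=
  (lintegral_mono_ae (ae_restrict_of_ae hu1)).trans (by simp)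

omit hu in
lemma ofReal_negMulLog_lintegral_eq {S : Set M} (hS : τ S ≠ 0) :
    ENNReal.ofReal (Real.negMulLog (∫⁻ x in S, u x ∂τ).toReal)
      = ENNReal.ofReal (Real.negMulLog (τ S).toReal) * ((∫⁻ x in S, u x ∂τ) / τ S)
        + ENNReal.ofReal (τ.real S * Real.negMulLog ((∫⁻ x in S, u x ∂τ).toReal / τ.real S)) := by
  have ht : 0 < τ.real S := ENNReal.toReal_pos hS (measure_ne_top _ _)
  have hm := lintegral_le_measure_of_le_one hu1 S
  have hm' : (∫⁻ x in S, u x ∂τ).toReal ≤ τ.real S := ENNReal.toReal_mono (measure_ne_top _ _) hm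
  have hmt : (∫⁻ x in S, u x ∂τ) ≠ ⊤ := ne_top_of_le_ne_top (measure_ne_top _ _) hm
  have hφ : 0 ≤ Real.negMulLog (τ.real S) := Real.negMulLog_nonneg ht.le measureReal_le_one
  have hφ2 : 0 ≤ Real.negMulLog ((∫⁻ x in S, u x ∂τ).toReal / τ.real S) :=
    Real.negMulLog_nonneg (by positivity) ((div_le_one ht).2 hm')
  rw [negMulLog_eq_add ht.ne', ENNReal.ofReal_add (by positivity) (by positivity), mul_comm,
    ENNReal.ofReal_mul hφ, ENNReal.ofReal_div_of_pos ht, ENNReal.ofReal_toReal hmt,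
    ofReal_measureReal]
  rfl

lemma le_ofReal_negMulLog_lintegral (S : Set M) :
    ENNReal.ofReal (Real.negMulLog (τ S).toReal) * ((∫⁻ x in S, u x ∂τ) / τ S)
        + ∫⁻ x in S, ENNReal.ofReal (Real.negMulLog (u x).toReal) ∂τ
      ≤ ENNReal.ofReal (Real.negMulLog (∫⁻ x in S, u x ∂τ).toReal) := by
  by_cases hS : τ S = 0
  · simp [hS, Measure.restrict_eq_zero.2 hS]
  rw [ofReal_negMulLog_lintegral_eq hu1 hS, lintegral_ofReal_negMulLog hu hu1]
  gcongr
  have := setIntegral_negMulLog_le hu.ennreal_toReal (ae_toReal_mem_Icc hu1) hS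
  rwa [integral_toReal_of_le_one hu hu1] at this

lemma ofReal_negMulLog_lintegral_le {S : Set M} (hSm : MeasurableSet S) {δ ε : ℝ}
    (hδ : ∀ x ∈ S, ∀ y ∈ S, |(u x).toReal - (u y).toReal| ≤ δ) (hε0 : 0 ≤ ε)
    (hε : ∀ s ∈ Icc (0 : ℝ) 1, ∀ t ∈ Icc (0 : ℝ) 1, |s - t| ≤ δ →
      |Real.negMulLog s - Real.negMulLog t| ≤ ε) :
    ENNReal.ofReal (Real.negMulLog (∫⁻ x in S, u x ∂τ).toReal)
      ≤ ENNReal.ofReal (Real.negMulLog (τ S).toReal) * ((∫⁻ x in S, u x ∂τ) / τ S)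
        + ∫⁻ x in S, ENNReal.ofReal (Real.negMulLog (u x).toReal) ∂τ
        + ENNReal.ofReal ε * τ S := by
  by_cases hS : τ S = 0
  · simp [hS, Measure.restrict_eq_zero.2 hS]
  rw [ofReal_negMulLog_lintegral_eq hu1 hS, lintegral_ofReal_negMulLog hu hu1, add_assoc]
  gcongr
  have := le_setIntegral_negMulLog_add hu.ennreal_toReal (ae_toReal_mem_Icc hu1) hSm hS hδ hε
  rw [integral_toReal_of_le_one hu hu1] at this
  refine (ENNReal.ofReal_le_ofReal this).trans (ENNReal.ofReal_add_le.trans ?_)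
  rw [ENNReal.ofReal_mul hε0, ofReal_measureReal]

end CellEstimatesENNReal

section ComponentEntropy

variable {r : ℕ} {X : Type*} [mX : MeasurableSpace X] {T : BorelAction (FG r) X}
  {μ : Measure X} [IsProbabilityMeasure μ] {τ : Measure (Measure X)} [IsProbabilityMeasure τ]
  {I J K : Type*} [Countable J] [MeasurableSpace J] [MeasurableSingletonClass J]
  [Countable K] [MeasurableSpace K] [MeasurableSingletonClass K]
  [Countable I] [MeasurableSpace I] [MeasurableSingletonClass I]

/-- The average over the components of the entropy of a partition. -/
noncomputable def compEnt (τ : Measure (Measure X)) (c : X → J) : ℝ≥0∞ := ∫⁻ ν, Hpart ν c ∂τ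

omit [Countable J] in
lemma measurable_ofReal_negMulLog {c : X → J} (hc : Measurable c) (j : J) :
    Measurable fun ν : Measure X => ENNReal.ofReal (Real.negMulLog (ν (c ⁻¹' {j})).toReal) :=
  (Real.continuous_negMulLog.measurable.comp
    (Measure.measurable_coe (hc (measurableSet_singleton j))).ennreal_toReal).ennreal_ofReal

lemma measurable_Hpart {c : X → J} (hc : Measurable c) :
    Measurable fun ν : Measure X => Hpart ν c :=
  Measurable.tsum fun j => measurable_ofReal_negMulLog hc j

lemma Hpart_le_of_factorsThrough (ν : Measure X) [IsFiniteMeasure ν] {b : X → I} {c : X → J}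
    (hb : Measurable b) (hc : Measurable c) (h : c.FactorsThrough b) :
    Hpart ν c ≤ Hpart ν b := by
  rw [Hpart_eq_ent ν hb, Hpart_eq_ent ν hc]
  exact ent_le_of_factorsThrough ν h

variable {p : X → K} {q : Measure X → K}

omit [IsProbabilityMeasure μ] [IsProbabilityMeasure τ] [Countable K] in
lemma Represents.measure_preimage (h : Decomposes T μ τ) (hp : Measurable p) (hq : Measurable q)
    (hpq : Represents τ p q) (k : K) : μ (p ⁻¹' {k}) = τ (q ⁻¹' {k}) := by
  have := hpq.measure_inter_eq h hp hq MeasurableSet.univ k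
  rw [univ_inter] at this
  rw [this, setLIntegral_congr_fun_ae (g := fun _ => 1) (hq (measurableSet_singleton k))]
  · simp
  · filter_upwards [h.inv] with ν hν _
    exact hν.1.measure_univ

omit [IsProbabilityMeasure τ] [MeasurableSpace J] [MeasurableSingletonClass J] in
lemma tsum_setLIntegral_fiber (hq : Measurable q) (f : J → Measure X → ℝ≥0∞)
    (hf : ∀ j, Measurable (f j)) :
    ∑' x : J × K, ∫⁻ ν in q ⁻¹' {x.2}, f x.1 ν ∂τ = ∫⁻ ν, ∑' j, f j ν ∂τ := by
  rw [ENNReal.tsum_prod (f := fun j k => ∫⁻ ν in q ⁻¹' {k}, f j ν ∂τ),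
    lintegral_tsum fun j => (hf j).aemeasurable]
  refine tsum_congr fun j => ?_
  rw [← lintegral_iUnion (fun k => hq (measurableSet_singleton k))
    (fun k l hkl => Disjoint.preimage q (by simpa using hkl))]
  rw [← preimage_iUnion, iUnion_of_singleton, preimage_univ, Measure.restrict_univ]

omit [IsProbabilityMeasure μ] in
lemma tsum_mul_div_eq (h : Decomposes T μ τ) (hp : Measurable p) (hq : Measurable q)
    (hpq : Represents τ p q) {c : X → J} (hc : Measurable c) :
    ∑' x : J × K, ENNReal.ofReal (Real.negMulLog (τ (q ⁻¹' {x.2})).toReal)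
      * ((∫⁻ ν in q ⁻¹' {x.2}, ν (c ⁻¹' {x.1}) ∂τ) / τ (q ⁻¹' {x.2})) = Hpart τ q := by
  rw [ENNReal.tsum_prod (f := fun j k => ENNReal.ofReal (Real.negMulLog (τ (q ⁻¹' {k})).toReal)
    * ((∫⁻ ν in q ⁻¹' {k}, ν (c ⁻¹' {j}) ∂τ) / τ (q ⁻¹' {k}))), ENNReal.tsum_comm]
  refine tsum_congr fun k => ?_
  rw [ENNReal.tsum_mul_left]
  by_cases hk : τ (q ⁻¹' {k}) = 0
  · simp [hk]
  simp_rw [div_eq_mul_inv]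
  rw [ENNReal.tsum_mul_right]
  simp_rw [← hpq.measure_inter_eq h hp hq (hc (measurableSet_singleton _)) k]
  rw [tsum_measure_fiber_inter μ hc (hp (measurableSet_singleton k)),
    hpq.measure_preimage h hp hq, ENNReal.mul_inv_cancel hk (measure_ne_top _ _), mul_one]

omit [IsProbabilityMeasure μ] [IsProbabilityMeasure τ] in
lemma Hpart_prod_eq (h : Decomposes T μ τ) (hp : Measurable p) (hq : Measurable q)
    (hpq : Represents τ p q) {c : X → J} (hc : Measurable c) :
    Hpart μ (fun x => (c x, p x)) = ∑' x : J × K,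
      ENNReal.ofReal (Real.negMulLog (∫⁻ ν in q ⁻¹' {x.2}, ν (c ⁻¹' {x.1}) ∂τ).toReal) := by
  refine tsum_congr fun x => ?_
  rw [← hpq.measure_inter_eq h hp hq (hc (measurableSet_singleton _)) x.2]
  congr 4
  ext y
  simp [Prod.ext_iff]

omit [IsProbabilityMeasure τ] [IsProbabilityMeasure μ] in
lemma Decomposes.ae_measure_le_one (h : Decomposes T μ τ) (B : Set X) : ∀ᵐ ν ∂τ, ν B ≤ 1 := by
  filter_upwards [h.inv] with ν hν
  have := hν.1
  exact prob_le_one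

omit [IsProbabilityMeasure μ] in
lemma Hpart_add_compEnt_le (h : Decomposes T μ τ) (hp : Measurable p) (hq : Measurable q)
    (hpq : Represents τ p q) {c : X → J} (hc : Measurable c) :
    Hpart τ q + compEnt τ c ≤ Hpart μ (fun x => (c x, p x)) := by
  rw [Hpart_prod_eq h hp hq hpq hc, ← tsum_mul_div_eq h hp hq hpq hc, compEnt]
  simp_rw [Hpart]
  rw [← tsum_setLIntegral_fiber hq _ (measurable_ofReal_negMulLog hc), ← ENNReal.tsum_add]
  exact ENNReal.tsum_le_tsum fun x => le_ofReal_negMulLog_lintegral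
    (Measure.measurable_coe (hc (measurableSet_singleton x.1))) (h.ae_measure_le_one _) _

lemma compEnt_le_Hpart (h : Decomposes T μ τ) {c : X → J} (hc : Measurable c) :
    compEnt τ c ≤ Hpart μ c := by
  have h1 := Hpart_add_compEnt_le h (p := fun _ => ()) (q := fun _ => ()) measurable_const
    measurable_const (ae_of_all _ fun ν => ae_of_all _ fun x => rfl) hc
  refine (le_add_self.trans h1).trans ?_
  exact Hpart_le_of_factorsThrough μ hc (hc.prodMk measurable_const) fun x y hxy => by
    simpa using hxy

omit [IsProbabilityMeasure μ] in
lemma Hpart_prod_le_of_oscillation (h : Decomposes T μ τ) (hp : Measurable p) (hq : Measurable q)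
    (hpq : Represents τ p q) [Fintype J] {c : X → J} (hc : Measurable c) {δ ε : ℝ}
    (hδ : ∀ ν ν' : Measure X, q ν = q ν' → ∀ j,
      |(min (ν (c ⁻¹' {j})) 1).toReal - (min (ν' (c ⁻¹' {j})) 1).toReal| ≤ δ)
    (hε0 : 0 ≤ ε) (hε : ∀ s ∈ Icc (0 : ℝ) 1, ∀ t ∈ Icc (0 : ℝ) 1, |s - t| ≤ δ →
      |Real.negMulLog s - Real.negMulLog t| ≤ ε) :
    Hpart μ (fun x => (c x, p x))
      ≤ Hpart τ q + compEnt τ c + Fintype.card J * ENNReal.ofReal ε := by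
  have hcard : ∑' x : J × K, ENNReal.ofReal ε * τ (q ⁻¹' {x.2})
      = Fintype.card J * ENNReal.ofReal ε := by
    rw [ENNReal.tsum_prod (f := fun _ k => ENNReal.ofReal ε * τ (q ⁻¹' {k})), tsum_fintype]
    simp_rw [ENNReal.tsum_mul_left]
    have : ∑' k, τ (q ⁻¹' {k}) = 1 := by
      have := tsum_measure_fiber_inter τ hq MeasurableSet.univ
      simpa using this
    simp [this]
  rw [Hpart_prod_eq h hp hq hpq hc, ← tsum_mul_div_eq h hp hq hpq hc, compEnt]
  simp_rw [Hpart]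
  rw [← tsum_setLIntegral_fiber hq _ (measurable_ofReal_negMulLog hc), ← ENNReal.tsum_add,
    ← hcard, ← ENNReal.tsum_add]
  refine ENNReal.tsum_le_tsum fun x => ?_
  have hm : Measurable fun ν : Measure X => min (ν (c ⁻¹' {x.1})) 1 :=
    (Measure.measurable_coe (hc (measurableSet_singleton x.1))).min measurable_const
  have hae : ∀ᵐ ν ∂τ.restrict (q ⁻¹' {x.2}), min (ν (c ⁻¹' {x.1})) 1 = ν (c ⁻¹' {x.1}) :=
    ae_restrict_of_ae ((h.ae_measure_le_one _).mono fun ν hν => min_eq_left hν)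
  have h1 := ofReal_negMulLog_lintegral_le (τ := τ) hm
    (ae_of_all _ fun ν => min_le_right _ _) (hq (measurableSet_singleton x.2))
    (fun ν hν ν' hν' => hδ ν ν' (hν.trans hν'.symm) x.1) hε0 hε
  rw [lintegral_congr_ae hae] at h1
  refine h1.trans_eq ?_
  congr 2
  refine lintegral_congr_ae ?_
  filter_upwards [hae] with ν hν
  rw [hν]

lemma exists_quantization (L : ℕ) :
    ∃ g : ℝ≥0∞ → Fin (L + 2), Measurable g ∧
      ∀ s t, g s = g t → |(min s 1).toReal - (min t 1).toReal| ≤ 1 / ((L : ℝ) + 1) := by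
  refine ⟨fun s => ⟨min ⌊(min s 1).toReal * (L + 1)⌋₊ (L + 1), by omega⟩, ?_, fun s t hst => ?_⟩
  · exact (Measurable.of_discrete
      (f := fun n : ℕ => (⟨min n (L + 1), by omega⟩ : Fin (L + 2)))).comp
      (Nat.measurable_floor.comp ((measurable_id.min measurable_const).ennreal_toReal.mul_const _))
  · have hb : ∀ s : ℝ≥0∞, ⌊(min s 1).toReal * (L + 1)⌋₊ ≤ L + 1 := fun s => by
      refine Nat.floor_le_of_le ?_
      have : (min s 1).toReal ≤ 1 :=
        ENNReal.toReal_le_of_le_ofReal zero_le_one (by simp)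
      push_cast
      nlinarith [(Nat.cast_nonneg L : (0 : ℝ) ≤ L)]
    have hfl : ⌊(min s 1).toReal * ((L : ℝ) + 1)⌋₊ = ⌊(min t 1).toReal * ((L : ℝ) + 1)⌋₊ := by
      have := congrArg Fin.val hst
      simpa [min_eq_left (hb s), min_eq_left (hb t)] using this
    have hL : (0 : ℝ) < (L : ℝ) + 1 := by positivity
    have hs1 := Nat.floor_le (show 0 ≤ (min s 1).toReal * ((L : ℝ) + 1) by positivity)
    have ht1 := Nat.floor_le (show 0 ≤ (min t 1).toReal * ((L : ℝ) + 1) by positivity)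
    have hs2 := Nat.lt_floor_add_one ((min s 1).toReal * ((L : ℝ) + 1))
    have ht2 := Nat.lt_floor_add_one ((min t 1).toReal * ((L : ℝ) + 1))
    rw [hfl] at hs1 hs2
    nth_rewrite 1 [le_div_iff₀ hL, ← abs_of_pos hL]
    rw [← abs_mul, sub_mul, abs_le]
    constructor <;> linarith

/-- Every finite family of finite-valued measurable functions factors through a single one. -/
lemma exists_common_refinement {M ι : Type*} [MeasurableSpace M] [Finite ι] {N : ι → ℕ}
    {q : ∀ i, M → Fin (N i)} (hq : ∀ i, Measurable (q i)) :
    ∃ (n : ℕ) (q' : M → Fin n), Measurable q' ∧ ∀ i, (q i).FactorsThrough q' := by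
  let e := Finite.equivFin (∀ i, Fin (N i))
  refine ⟨_, fun m => e fun i => q i m, (Measurable.of_discrete (f := e)).comp
    (measurable_pi_lambda _ hq), fun i m m' h => ?_⟩
  exact congrFun (e.injective h) i

omit [IsProbabilityMeasure μ] in
lemma exists_approx_of_finite (h : Decomposes T μ τ) [Finite J] {c : X → J} (hc : Measurable c)
    {ε : ℝ} (hε : 0 < ε) :
    ∃ (N : ℕ) (q₀ : Measure X → Fin N), Measurable q₀ ∧
      ∀ (n : ℕ) (q : Measure X → Fin n) (p : X → Fin n), Measurable p → Measurable q →
        Represents τ p q → q₀.FactorsThrough q →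
          Hpart μ (fun x => (c x, p x)) ≤ Hpart τ q + compEnt τ c + ENNReal.ofReal ε := by
  have := Fintype.ofFinite J
  set ε' : ℝ := ε / (Fintype.card J + 1) with hε'
  have hε'0 : 0 < ε' := by positivity
  obtain ⟨δ, hδ0, hδ⟩ := Metric.uniformContinuousOn_iff_le.1
    (isCompact_Icc.uniformContinuousOn_of_continuous
      (Real.continuous_negMulLog.continuousOn (s := Icc (0 : ℝ) 1))) ε' hε'0
  obtain ⟨L, hL⟩ := exists_nat_one_div_lt hδ0
  obtain ⟨g, hg, hgL⟩ := exists_quantization L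
  obtain ⟨N, q₀, hq₀, hfac⟩ := exists_common_refinement
    (q := fun (j : J) (ν : Measure X) => g (ν (c ⁻¹' {j})))
    (fun j => hg.comp (Measure.measurable_coe (hc (measurableSet_singleton j))))
  refine ⟨N, q₀, hq₀, fun n q p hp hq hpq hq₀q => ?_⟩
  refine (Hpart_prod_le_of_oscillation h hp hq hpq hc (δ := δ) (ε := ε') ?_ hε'0.le ?_).trans ?_
  · exact fun ν ν' hν j => (hgL _ _ (hfac j (hq₀q hν))).trans hL.le
  · exact fun s hs t ht hst => hδ s hs t ht hst
  · gcongr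
    rw [← ENNReal.ofReal_natCast, ← ENNReal.ofReal_mul (by positivity)]
    refine ENNReal.ofReal_le_ofReal ?_
    rw [hε', mul_div_assoc', div_le_iff₀ (by positivity)]
    nlinarith

omit [IsProbabilityMeasure μ] in
lemma exists_finite_coarsening {c : X → J} (hc : Measurable c) (hfin : Hpart μ c < ⊤)
    {ε : ℝ} (hε : 0 < ε) :
    ∃ (n : ℕ) (c' : X → Fin n), Measurable c' ∧ c'.FactorsThrough c ∧
      Hpart μ c ≤ Hpart μ c' + ENNReal.ofReal ε := by
  classical
  obtain ⟨s, hs⟩ : ∃ s : Finset J, Hpart μ c ≤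
      ∑ j ∈ s, ENNReal.ofReal (Real.negMulLog (μ (c ⁻¹' {j})).toReal) + ENNReal.ofReal ε := by
    by_cases h0 : Hpart μ c = 0
    · exact ⟨∅, by simp [h0]⟩
    have hlt : Hpart μ c - ENNReal.ofReal ε < Hpart μ c :=
      ENNReal.sub_lt_self hfin.ne h0 (by simpa using hε)
    rw [Hpart, ENNReal.tsum_eq_iSup_sum, lt_iSup_iff] at hlt
    obtain ⟨s, hs⟩ := hlt
    refine ⟨s, ?_⟩
    rw [← ENNReal.tsum_eq_iSup_sum] at hs
    exact tsub_le_iff_right.1 hs.le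
  let e := Finite.equivFin (Option s)
  let f : J → Option s := fun j => if hj : j ∈ s then some ⟨j, hj⟩ else none
  let f' : J → Fin (Nat.card (Option s)) := fun j => e (f j)
  have hf : Measurable f' := measurable_of_countable f'
  refine ⟨_, f' ∘ c, hf.comp hc, fun x y hxy => congrArg f' hxy, hs.trans ?_⟩
  gcongr
  have hpre : ∀ j : s, (f' ∘ c) ⁻¹' {e (some j)} = c ⁻¹' {j.1} := fun j => by
    ext x
    simp only [mem_preimage, Function.comp_apply, mem_singleton_iff, f', f, e.apply_eq_iff_eq]
    constructor
    · intro hx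
      split_ifs at hx with hm
      exact congrArg Subtype.val (Option.some.inj hx)
    · intro hx
      rw [dif_pos (hx ▸ j.2)]
      exact congrArg some (Subtype.ext hx)
  calc ∑ j ∈ s, ENNReal.ofReal (Real.negMulLog (μ (c ⁻¹' {j})).toReal)
      = ∑ j : s, ENNReal.ofReal (Real.negMulLog (μ ((f' ∘ c) ⁻¹' {e (some j)})).toReal) := by
        simp_rw [hpre]
        exact (Finset.sum_coe_sort s
          fun j => ENNReal.ofReal (Real.negMulLog (μ (c ⁻¹' {j})).toReal)).symm
    _ ≤ Hpart μ (f' ∘ c) := by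
        rw [Hpart, tsum_fintype, ← e.sum_comp, Fintype.sum_option]
        exact le_add_self

/-- For a finite-entropy partition `c`, sufficiently fine functions `q` of the component capture
the component entropy of `c` up to `ε`. -/
lemma exists_approx (h : Decomposes T μ τ) {c : X → J} (hc : Measurable c)
    (hfin : Hpart μ c < ⊤) {ε : ℝ} (hε : 0 < ε) :
    ∃ (N : ℕ) (q₀ : Measure X → Fin N), Measurable q₀ ∧
      ∀ (n : ℕ) (q : Measure X → Fin n) (p : X → Fin n), Measurable p → Measurable q →
        Represents τ p q → q₀.FactorsThrough q →
          Hpart μ (fun x => (c x, p x)) ≤ Hpart τ q + compEnt τ c + ENNReal.ofReal ε := by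
  obtain ⟨s, c', hc', hfac, hle⟩ := exists_finite_coarsening hc hfin (half_pos hε)
  obtain ⟨N, q₀, hq₀, happ⟩ := exists_approx_of_finite h hc' (half_pos hε)
  refine ⟨N, q₀, hq₀, fun n q p hp hq hpq hq₀q => ?_⟩
  have h1 := happ n q p hp hq hpq hq₀q
  have hcomp : compEnt τ c' ≤ compEnt τ c := lintegral_mono_ae <| by
    filter_upwards [h.inv] with ν hν
    have := hν.1
    exact Hpart_le_of_factorsThrough ν hc hc' hfac
  have hsub := ent_submodular μ (a := c) (b := fun x => (c' x, p x)) (c := c')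
    (d := fun x => (c x, p x)) hc (hc'.prodMk hp) hc' hfac (fun x y hxy => congrArg Prod.fst hxy)
    (fun x y hxy => by simp only [Prod.mk.injEq] at hxy ⊢; exact ⟨hxy.1, hxy.2.2⟩)
  rw [← Hpart_eq_ent μ hc, ← Hpart_eq_ent μ hc', ← Hpart_eq_ent μ (hc.prodMk hp),
    ← Hpart_eq_ent μ (hc'.prodMk hp)] at hsub
  have hc'fin : Hpart μ c' ≠ ⊤ := ((Hpart_le_of_factorsThrough μ hc hc' hfac).trans_lt hfin).ne
  refine (ENNReal.add_le_add_iff_right hc'fin).1 (hsub.trans ?_)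
  calc Hpart μ c + Hpart μ (fun x => (c' x, p x))
      ≤ (Hpart μ c' + ENNReal.ofReal (ε / 2))
        + (Hpart τ q + compEnt τ c + ENNReal.ofReal (ε / 2)) := by
        gcongr
        exact h1.trans (by gcongr)
    _ = Hpart τ q + compEnt τ c + (ENNReal.ofReal (ε / 2) + ENNReal.ofReal (ε / 2))
        + Hpart μ c' := by ring
    _ = _ := by rw [← ENNReal.ofReal_add (by positivity) (by positivity), add_halves]

end ComponentEntropy

section MeasureEntropy

variable {M : Type*} [MeasurableSpace M]

lemma Hpart_le_measEnt (τ : Measure M) {n : ℕ} {q : M → Fin n} (hq : Measurable q) :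
    Hpart τ q ≤ measEnt τ := by
  classical
  set P : Finset (Set M) := Finset.univ.image fun k => q ⁻¹' {k} with hP
  have hdisj : ∀ k l : Fin n, k ≠ l → Disjoint (q ⁻¹' {k}) (q ⁻¹' {l}) := fun k l hkl =>
    Disjoint.preimage q (by simpa using hkl)
  have hsum : Hpart τ q ≤ ∑ s ∈ P, ENNReal.ofReal (Real.negMulLog (τ s).toReal) := by
    rw [Hpart, tsum_fintype, hP, Finset.sum_image_of_pairwise_eq_zero]
    intro k _ l _ hkl heq
    have : q ⁻¹' {k} = ∅ := by
      have := hdisj k l hkl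
      rw [← heq] at this
      exact disjoint_self.1 this
    simp [this]
  refine hsum.trans (le_iSup_of_le P
    (le_iSup_of_le ?_ (le_iSup_of_le ?_ (le_iSup_of_le ?_ le_rfl))))
  · intro s hs
    obtain ⟨k, -, rfl⟩ := Finset.mem_image.1 hs
    exact hq (measurableSet_singleton k)
  · intro s hs t ht hst
    obtain ⟨k, -, rfl⟩ := Finset.mem_image.1 hs
    obtain ⟨l, -, rfl⟩ := Finset.mem_image.1 ht
    exact hdisj k l fun hkl => hst (by rw [hkl])
  · refine eq_univ_of_forall fun m => ⟨q ⁻¹' {q m}, ?_, rfl⟩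
    simp [hP]

lemma exists_lt_Hpart_of_lt_measEnt {τ : Measure M} {b : ℝ≥0∞} (hb : b < measEnt τ) :
    ∃ (n : ℕ) (q : M → Fin n), Measurable q ∧ b < Hpart τ q := by
  classical
  simp only [measEnt, lt_iSup_iff] at hb
  obtain ⟨P, hPm, hPd, hPu, hb⟩ := hb
  have hcover : ∀ m : M, ∃ s : P, m ∈ s.1 := fun m => by
    obtain ⟨s, hs, hms⟩ := (hPu.symm ▸ mem_univ m : m ∈ ⋃₀ (P : Set (Set M)))
    exact ⟨⟨s, hs⟩, hms⟩
  choose f hf using hcover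
  let e := P.equivFin
  have hpre : ∀ k, (fun m => e (f m)) ⁻¹' {k} = (e.symm k).1 := fun k => by
    ext m
    simp only [mem_preimage, mem_singleton_iff]
    constructor
    · rintro rfl
      simpa using hf m
    · intro hm
      rw [← Equiv.eq_symm_apply]
      by_contra hne
      exact disjoint_left.1 (hPd (f m).2 (e.symm k).2 fun h => hne (Subtype.ext h)) (hf m) hm
  refine ⟨_, fun m => e (f m), measurable_to_countable' fun k => ?_, hb.trans_eq ?_⟩
  · rw [hpre]
    exact hPm _ (e.symm k).2
  · rw [Hpart, tsum_fintype]
    simp_rw [hpre]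
    rw [Equiv.sum_comp e.symm fun s : P => ENNReal.ofReal (Real.negMulLog (τ s.1).toReal)]
    exact (Finset.sum_coe_sort P fun s => ENNReal.ofReal (Real.negMulLog (τ s).toReal)).symm

end MeasureEntropy

section Comparison

variable {r : ℕ} {X : Type*} [mX : MeasurableSpace X] {T : BorelAction (FG r) X}
  {μ : Measure X} [IsProbabilityMeasure μ] {τ : Measure (Measure X)} [IsProbabilityMeasure τ]
  {I : Type*} [Countable I] [MeasurableSpace I] [MeasurableSingletonClass I] {a : X → I}
  {K : Type*} [Finite K] [MeasurableSpace K] [MeasurableSingletonClass K]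
  {p : X → K} {q : Measure X → K}

/-- The average over the components of the entropy of `F · α`. -/
noncomputable def compJoinEnt (τ : Measure (Measure X)) (T : BorelAction (FG r) X) (a : X → I)
    (F : Set (FG r)) : ℝ := (∫⁻ ν, ent ν (T.joinF F a) ∂τ).toReal

/-- The analogue of `FF` for the averaged entropies of the components. -/
noncomputable def compFF (τ : Measure (Measure X)) (T : BorelAction (FG r) X) (a : X → I)
    (F : Set (FG r)) : ℝ :=
  (1 - 2 * (r : ℝ)) * compJoinEnt τ T a F
    + ∑ i : Fin r, compJoinEnt τ T a (F ∪ FreeGroup.of i • F)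

omit [IsProbabilityMeasure μ] [IsProbabilityMeasure τ] in
lemma Decomposes.compEnt_joinF (h : Decomposes T μ τ) (ha : Measurable a) (F : Set (FG r))
    [Finite F] : compEnt τ (T.joinF F a) = ∫⁻ ν, ent ν (T.joinF F a) ∂τ := by
  refine lintegral_congr_ae ?_
  filter_upwards [h.inv] with ν hν
  have := hν.1
  exact Hpart_eq_ent ν (measurable_joinF ha F)

omit [IsProbabilityMeasure τ] [MeasurableSpace I] [MeasurableSingletonClass I] in
lemma ent_joinF_prod_eq (h : Decomposes T μ τ) (hp : Measurable p) (hpq : Represents τ p q)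
    {F : Set (FG r)} (hF : F.Finite) (hne : F.Nonempty) :
    ent μ (T.joinF F fun x => (a x, p x)) = ent μ (fun x => (T.joinF F a x, p x)) := by
  have := hF.to_subtype
  have hae : T.joinF F (fun x => (a x, p x)) =ᵐ[μ]
      fun x f => (a (T.act (f : FG r)⁻¹ x), p x) := by
    have : ∀ᵐ x ∂μ, ∀ f : F, p (T.act (f : FG r)⁻¹ x) = p x :=
      ae_all_iff.2 fun f => Represents.comp_act_ae_eq h hp hpq (f : FG r)⁻¹
    filter_upwards [this] with x hx
    funext f
    simp [BorelAction.joinF, hx f]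
  rw [ent_congr_ae μ hae]
  obtain ⟨f₀, hf₀⟩ := hne
  refine ent_eq_of_factorsThrough μ (fun x y hxy => ?_) (fun x y hxy => ?_)
  · rw [Prod.mk.injEq] at hxy
    funext f
    exact Prod.ext (congrFun hxy.1 f) hxy.2
  · exact Prod.ext (funext fun f => congrArg Prod.fst (congrFun hxy f))
      (Prod.ext_iff.1 (congrFun hxy ⟨f₀, hf₀⟩)).2

lemma ent_prod_lt_top (ha : Measurable a) (hent : ent μ a < ⊤) (hp : Measurable p) :
    ent μ (fun x => (a x, p x)) < ⊤ :=
  (ent_prod_le μ ha hp).trans_lt (ENNReal.add_lt_top.2 ⟨hent, ent_lt_top_of_finite μ hp⟩)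

section

variable (h : Decomposes T μ τ) (hT : T.Preserves μ) (ha : Measurable a) (hent : ent μ a < ⊤)
include h hT ha hent

lemma compEnt_joinF_lt_top {F : Set (FG r)} (hF : F.Finite) :
    ∫⁻ ν, ent ν (T.joinF F a) ∂τ < ⊤ := by
  have := hF.to_subtype
  rw [← h.compEnt_joinF ha]
  refine (compEnt_le_Hpart h (measurable_joinF ha F)).trans_lt ?_
  rw [Hpart_eq_ent μ (measurable_joinF ha F)]
  exact ent_joinF_lt_top μ T hT ha hent hF

lemma toReal_Hpart_add_compJoinEnt_le (hp : Measurable p) (hq : Measurable q)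
    (hpq : Represents τ p q) {F : Set (FG r)} (hF : F.Finite) (hne : F.Nonempty) :
    (Hpart τ q).toReal + compJoinEnt τ T a F ≤ joinEnt μ T (fun x => (a x, p x)) F := by
  have := hF.to_subtype
  have hle := Hpart_add_compEnt_le h hp hq hpq (measurable_joinF (T := T) ha F)
  rw [h.compEnt_joinF ha, Hpart_eq_ent μ ((measurable_joinF ha F).prodMk hp),
    ← ent_joinF_prod_eq h hp hpq hF hne] at hle
  have hτ : Hpart τ q ≠ ⊤ := by
    rw [Hpart_eq_ent τ hq]
    exact (ent_lt_top_of_finite τ hq).ne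
  rw [compJoinEnt, ← ENNReal.toReal_add hτ (compEnt_joinF_lt_top h hT ha hent hF).ne]
  exact ENNReal.toReal_mono (ent_joinF_lt_top μ T hT (ha.prodMk hp)
    (ent_prod_lt_top ha hent hp) hF).ne hle

/-- Component-measurable partitions `p` fine enough for the conditional entropies of finitely many
joins `F i · α` given `p` to be within `ε` of the averaged entropies. -/
lemma exists_adapted {ι : Type*} [Finite ι] {F : ι → Set (FG r)} (hF : ∀ i, (F i).Finite)
    (hne : ∀ i, (F i).Nonempty) {N : ℕ} {q₀ : Measure X → Fin N} (hq₀ : Measurable q₀)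
    {ε : ℝ} (hε : 0 < ε) :
    ∃ (n : ℕ) (q : Measure X → Fin n) (p : X → Fin n), Measurable q ∧ Measurable p ∧
      Represents τ p q ∧ q₀.FactorsThrough q ∧
      ∀ i, joinEnt μ T (fun x => (a x, p x)) (F i)
        ≤ (Hpart τ q).toReal + compJoinEnt τ T a (F i) + ε := by
  have hfin := fun i => (hF i).to_subtype
  have happ := fun i => exists_approx h (measurable_joinF (T := T) ha (F i))
    (by
      rw [Hpart_eq_ent μ (measurable_joinF ha (F i))]
      exact ent_joinF_lt_top μ T hT ha hent (hF i)) hε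
  choose k q₁ hq₁ happ using happ
  let s : Option ι → Σ n : ℕ, (Measure X → Fin n) := fun o => o.elim ⟨N, q₀⟩ fun i => ⟨k i, q₁ i⟩
  obtain ⟨n, q, hq, hsq⟩ := exists_common_refinement (q := fun o => (s o).2) (fun o => by
    cases o with
    | none => exact hq₀
    | some i => exact hq₁ i)
  have : Nonempty (Fin n) := ⟨q 0⟩
  obtain ⟨p, hp, hpq⟩ := h.exists_represents hq
  refine ⟨n, q, p, hq, hp, hpq, hsq none, fun i => ?_⟩
  have hle := happ i n q p hp hq hpq (hsq (some i))
  rw [h.compEnt_joinF ha, Hpart_eq_ent μ ((measurable_joinF ha (F i)).prodMk hp),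
    ← ent_joinF_prod_eq h hp hpq (hF i) (hne i)] at hle
  have hτ : Hpart τ q ≠ ⊤ := by
    rw [Hpart_eq_ent τ hq]
    exact (ent_lt_top_of_finite τ hq).ne
  have hC := (compEnt_joinF_lt_top h hT ha hent (hF i)).ne
  have := ENNReal.toReal_mono (by simp [hτ, hC]) hle
  rwa [ENNReal.toReal_add (by simp [hτ, hC]) ENNReal.ofReal_ne_top, ENNReal.toReal_add hτ hC,
    ENNReal.toReal_ofReal hε.le] at this

omit h in
lemma joinEnt_prod_add_le (hp : Measurable p) {E F : Set (FG r)} (hF : F.Finite) (hEF : E ⊆ F)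
    (hne : E.Nonempty) (hinv : ∀ {G : Set (FG r)}, G.Finite → G.Nonempty →
      ent μ (T.joinF G fun x => (a x, p x)) = ent μ (fun x => (T.joinF G a x, p x))) :
    joinEnt μ T (fun x => (a x, p x)) F + joinEnt μ T a E
      ≤ joinEnt μ T a F + joinEnt μ T (fun x => (a x, p x)) E := by
  have hE := hF.subset hEF
  have := hF.to_subtype
  have := hE.to_subtype
  have hap := ent_prod_lt_top ha hent hp
  have fin := fun {G : Set (FG r)} (hG : G.Finite) => (ent_joinF_lt_top μ T hT ha hent hG).ne
  have finp := fun {G : Set (FG r)} (hG : G.Finite) =>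
    (ent_joinF_lt_top μ T hT (ha.prodMk hp) hap hG).ne
  unfold joinEnt
  rw [← ENNReal.toReal_add (finp hF) (fin hE), ← ENNReal.toReal_add (fin hF) (finp hE)]
  refine ENNReal.toReal_mono (ENNReal.add_ne_top.2 ⟨fin hF, finp hE⟩) ?_
  rw [hinv hF (hne.mono hEF), hinv hE hne]
  refine ent_submodular μ (measurable_joinF ha F) ((measurable_joinF ha E).prodMk hp)
    (measurable_joinF ha E) (joinF_factorsThrough T hEF a) (fun x y hxy => ?_)
    (fun x y hxy => ?_)
  · exact congrArg Prod.fst hxy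
  · simp only [Prod.mk.injEq] at hxy ⊢
    exact ⟨hxy.1, hxy.2.2⟩

omit h in
lemma joinEnt_le_joinEnt_prod (hp : Measurable p) {F : Set (FG r)} (hF : F.Finite) :
    joinEnt μ T a F ≤ joinEnt μ T (fun x => (a x, p x)) F := by
  have := hF.to_subtype
  refine ENNReal.toReal_mono (ent_joinF_lt_top μ T hT (ha.prodMk hp)
    (ent_prod_lt_top ha hent hp) hF).ne (ent_le_of_factorsThrough μ fun x y hxy => ?_)
  exact funext fun f => congrArg Prod.fst (congrFun hxy f)

omit h hT ha hent in
lemma ball_nonempty (r n : ℕ) : (ball r n).Nonempty :=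
  ⟨1, by simp [ball, wlen]⟩

/-- Upper bound for `f_G(X, μ)` by the averages over the components. -/
lemma exists_FF_le (hr : 1 ≤ r) (hgen : T.Generating a μ) (n : ℕ) {N : ℕ}
    {q₀ : Measure X → Fin N} (hq₀ : Measurable q₀) {ε : ℝ} (hε : 0 < ε) :
    ∃ m, FF μ T (T.joinF (ball r m) a)
      ≤ compFF τ T a (ball r n) - ((r : ℝ) - 1) * (Hpart τ q₀).toReal + ε := by
  have hr' : (1 : ℝ) ≤ r := by exact_mod_cast hr
  set δ : ℝ := ε / (3 * r) with hδ
  have hδ0 : 0 < δ := by positivity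
  have hball := fun k => toFinite (ball r k)
  obtain ⟨k, q, p, hq, hp, hpq, hq₀q, happ⟩ := exists_adapted h hT ha hent
    (F := fun i : Fin r => ball r n ∪ FreeGroup.of i • ball r n)
    (fun i => (hball n).union (hball n).smul_set)
    (fun i => (ball_nonempty r n).mono subset_union_left) hq₀ hδ0
  obtain ⟨m₀, hm₀⟩ := CondEntVanishes.of_finite hT ha hent hgen hp (ENNReal.ofReal δ)
    (by simpa using hδ0)
  set m := max m₀ n
  have hap := ent_prod_lt_top ha hent hp
  have hvan : joinEnt μ T (fun x => (a x, p x)) (ball r m) ≤ joinEnt μ T a (ball r m) + δ := by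
    have h1 := hm₀ m (le_max_left _ _)
    have h2 : ent μ (T.joinF (ball r m) fun x => (a x, p x))
        ≤ ent μ (T.joinF (ball r m) a) + ENNReal.ofReal δ := by
      rw [ent_joinF_prod_eq h hp hpq (hball m) (ball_nonempty r m)]
      refine (ent_le_of_factorsThrough μ fun x y hxy => ?_).trans h1
      simp only [Prod.mk.injEq] at hxy ⊢
      exact hxy.symm
    have h3 := (ent_joinF_lt_top μ T hT ha hent (hball m)).ne
    have := ENNReal.toReal_mono (by simp [h3]) h2
    rwa [ENNReal.toReal_add h3 ENNReal.ofReal_ne_top, ENNReal.toReal_ofReal hδ0.le] at this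
  have hanti := FF_joinF_ball_antitone hT (ha.prodMk hp) hap (le_max_right m₀ n)
  change FF μ T (T.joinF (ball r m) _) ≤ FF μ T (T.joinF (ball r n) _) at hanti
  rw [FF_joinF (ha.prodMk hp), FF_joinF (ha.prodMk hp)] at hanti
  have hlow := toReal_Hpart_add_compJoinEnt_le h hT ha hent hp hq hpq (hball n) (ball_nonempty r n)
  have hsum1 := Finset.sum_le_sum fun i (_ : i ∈ Finset.univ) => happ i
  have hsum2 := Finset.sum_le_sum fun i (_ : i ∈ (Finset.univ : Finset (Fin r))) =>
    joinEnt_le_joinEnt_prod hT ha hent hp (F := ball r m ∪ FreeGroup.of i • ball r m)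
      ((hball m).union (hball m).smul_set)
  simp only [Finset.sum_add_distrib, Finset.sum_const, Finset.card_univ, Fintype.card_fin,
    nsmul_eq_mul] at hsum1
  have hmono : (Hpart τ q₀).toReal ≤ (Hpart τ q).toReal := by
    refine ENNReal.toReal_mono ?_ (Hpart_le_of_factorsThrough τ hq hq₀ hq₀q)
    rw [Hpart_eq_ent τ hq]
    exact (ent_lt_top_of_finite τ hq).ne
  refine ⟨m, ?_⟩
  rw [FF_joinF ha, compFF]
  have h1 : (2 * (r : ℝ) - 1) * joinEnt μ T (fun x => (a x, p x)) (ball r m)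
      ≤ (2 * (r : ℝ) - 1) * (joinEnt μ T a (ball r m) + δ) :=
    mul_le_mul_of_nonneg_left hvan (by linarith)
  have h2 : (2 * (r : ℝ) - 1) * ((Hpart τ q).toReal + compJoinEnt τ T a (ball r n))
      ≤ (2 * (r : ℝ) - 1) * joinEnt μ T (fun x => (a x, p x)) (ball r n) :=
    mul_le_mul_of_nonneg_left hlow (by linarith)
  have h3 : ((r : ℝ) - 1) * (Hpart τ q₀).toReal ≤ ((r : ℝ) - 1) * (Hpart τ q).toReal :=
    mul_le_mul_of_nonneg_left hmono (by linarith)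
  have h4 : 3 * r * δ = ε := by
    rw [hδ]
    field_simp
  nlinarith

/-- Lower bound for `F_G(X, μ, S, B_n · α)` by the averages over the components. -/
lemma compFF_le_FF (hr : 1 ≤ r) (hτ : 1 < r → measEnt τ ≠ ⊤) (n : ℕ) :
    compFF τ T a (ball r n) ≤ FF μ T (T.joinF (ball r n) a)
      + ((r : ℝ) - 1) * (measEnt τ).toReal := by
  have hr' : (1 : ℝ) ≤ r := by exact_mod_cast hr
  have hball := toFinite (ball r n)
  have hne := ball_nonempty r n
  refine le_of_forall_pos_le_add fun ε hε => ?_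
  set δ : ℝ := ε / (2 * r) with hδ
  have hδ0 : 0 < δ := by positivity
  obtain ⟨k, q, p, hq, hp, hpq, -, happ⟩ := exists_adapted h hT ha hent
    (F := fun _ : Unit => ball r n) (fun _ => hball) (fun _ => hne)
    (q₀ := fun _ => (0 : Fin 1)) measurable_const hδ0
  have happ := happ ()
  have hJ : ((r : ℝ) - 1) * (joinEnt μ T a (ball r n) - compJoinEnt τ T a (ball r n))
      ≤ ((r : ℝ) - 1) * ((measEnt τ).toReal + δ) := by
    rcases hr.eq_or_lt with rfl | hlt
    · simp
    have hqτ : (Hpart τ q).toReal ≤ (measEnt τ).toReal :=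
      ENNReal.toReal_mono (hτ hlt) (Hpart_le_measEnt τ hq)
    have := joinEnt_le_joinEnt_prod hT ha hent hp hball
    exact mul_le_mul_of_nonneg_left (by linarith) (by linarith)
  have hstep : ∀ i : Fin r, compJoinEnt τ T a (ball r n ∪ FreeGroup.of i • ball r n)
      ≤ joinEnt μ T a (ball r n ∪ FreeGroup.of i • ball r n)
        + (compJoinEnt τ T a (ball r n) - joinEnt μ T a (ball r n) + δ) := fun i => by
    have hfin := hball.union (hball.smul_set (a := FreeGroup.of i))
    have h1 := joinEnt_prod_add_le hT ha hent hp hfin subset_union_left hne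
      fun hG hG' => ent_joinF_prod_eq h hp hpq hG hG'
    have h2 := toReal_Hpart_add_compJoinEnt_le h hT ha hent hp hq hpq hfin
      (hne.mono subset_union_left)
    linarith
  have hsum := Finset.sum_le_sum fun i (_ : i ∈ (Finset.univ : Finset (Fin r))) => hstep i
  simp only [Finset.sum_add_distrib, Finset.sum_const, Finset.card_univ, Fintype.card_fin,
    nsmul_eq_mul] at hsum
  rw [FF_joinF ha, compFF]
  have h4 : 2 * r * δ = ε := by
    rw [hδ]
    field_simp
  nlinarith

end

end Comparison

section ExtendedIntegral

open Topology

variable {M : Type*} [MeasurableSpace M]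

lemma erealToENNReal_iInf {u : ℕ → ℝ} (hu : Antitone u) :
    erealToENNReal (⨅ n, (u n : EReal)) = ⨅ n, ENNReal.ofReal (u n) := by
  have h1 : Tendsto (fun n => (u n : EReal)) atTop (𝓝 (⨅ n, (u n : EReal))) :=
    tendsto_atTop_iInf fun m n hmn => EReal.coe_le_coe_iff.2 (hu hmn)
  exact tendsto_nhds_unique ((EReal.continuous_toENNReal.tendsto _).comp h1)
    (tendsto_atTop_iInf fun m n hmn => ENNReal.ofReal_le_ofReal (hu hmn))

lemma erealToENNReal_neg_iInf {u : ℕ → ℝ} (hu : Antitone u) :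
    erealToENNReal (-⨅ n, (u n : EReal)) = ⨆ n, ENNReal.ofReal (-u n) := by
  have h1 : Tendsto (fun n => (u n : EReal)) atTop (𝓝 (⨅ n, (u n : EReal))) :=
    tendsto_atTop_iInf fun m n hmn => EReal.coe_le_coe_iff.2 (hu hmn)
  exact tendsto_nhds_unique
    ((EReal.continuous_toENNReal.tendsto _).comp ((continuous_neg.tendsto _).comp h1))
    (tendsto_atTop_iSup fun m n hmn => ENNReal.ofReal_le_ofReal (neg_le_neg (hu hmn)))

/-- Monotone convergence for `eIntegral` along a non-increasing sequence of real functions. -/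
lemma eIntegral_iInf {τ : Measure M} {f : ℕ → M → ℝ} (hf : ∀ n, Measurable (f n))
    (hint : ∀ n, Integrable (f n) τ) (hanti : ∀ᵐ m ∂τ, Antitone fun n => f n m) :
    eIntegral τ (fun m => ⨅ n, (f n m : EReal)) = ⨅ n, ((∫ m, f n m ∂τ : ℝ) : EReal) := by
  set P : ℕ → ℝ≥0∞ := fun n => ∫⁻ m, ENNReal.ofReal (f n m) ∂τ
  set Q : ℕ → ℝ≥0∞ := fun n => ∫⁻ m, ENNReal.ofReal (-f n m) ∂τ
  have hPfin : ∀ n, P n ≠ ⊤ := fun n => (hint n).lintegral_lt_top.ne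
  have hQfin : ∀ n, Q n ≠ ⊤ := fun n => (hint n).neg.lintegral_lt_top.ne
  have hPanti : Antitone P := fun m n hmn => lintegral_mono_ae <| by
    filter_upwards [hanti] with x hx using ENNReal.ofReal_le_ofReal (hx hmn)
  have hQmono : Monotone Q := fun m n hmn => lintegral_mono_ae <| by
    filter_upwards [hanti] with x hx using ENNReal.ofReal_le_ofReal (neg_le_neg (hx hmn))
  have hpos : ∫⁻ m, erealToENNReal (⨅ n, (f n m : EReal)) ∂τ = ⨅ n, P n := by
    rw [← lintegral_iInf_ae (fun n => (hf n).ennreal_ofReal) (fun n => ?_) (hPfin 0)]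
    · refine lintegral_congr_ae ?_
      filter_upwards [hanti] with x hx using erealToENNReal_iInf hx
    · filter_upwards [hanti] with x hx using ENNReal.ofReal_le_ofReal (hx n.le_succ)
  have hneg : ∫⁻ m, erealToENNReal (-⨅ n, (f n m : EReal)) ∂τ = ⨆ n, Q n := by
    rw [← lintegral_iSup' (f := fun n m => ENNReal.ofReal (-f n m))
      (fun n => (hf n).neg.ennreal_ofReal.aemeasurable)]
    · refine lintegral_congr_ae ?_
      filter_upwards [hanti] with x hx using erealToENNReal_neg_iInf hx
    · filter_upwards [hanti] with x hx m n hmn using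
        ENNReal.ofReal_le_ofReal (neg_le_neg (hx hmn))
  have hterm : ∀ n, ((∫ m, f n m ∂τ : ℝ) : EReal) = (P n : EReal) - (Q n : EReal) := fun n => by
    rw [integral_eq_lintegral_pos_part_sub_lintegral_neg_part (hint n), EReal.coe_sub,
      EReal.coe_ennreal_toReal (hPfin n), EReal.coe_ennreal_toReal (hQfin n)]
  have hPinf : (⨅ n, P n) ≠ ⊤ := ((iInf_le P 0).trans_lt (hPfin 0).lt_top).ne
  have hlim : Tendsto (fun n => (P n : EReal) - (Q n : EReal)) atTop
      (𝓝 (((⨅ n, P n : ℝ≥0∞) : EReal) - ((⨆ n, Q n : ℝ≥0∞) : EReal))) := by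
    have h1 : Tendsto (fun n => (P n : EReal)) atTop (𝓝 ((⨅ n, P n : ℝ≥0∞) : EReal)) :=
      (continuous_coe_ennreal_ereal.tendsto _).comp (tendsto_atTop_iInf hPanti)
    have h2 : Tendsto (fun n => (Q n : EReal)) atTop (𝓝 ((⨆ n, Q n : ℝ≥0∞) : EReal)) :=
      (continuous_coe_ennreal_ereal.tendsto _).comp (tendsto_atTop_iSup hQmono)
    simp only [sub_eq_add_neg]
    refine (EReal.continuousAt_add (p := (_, _)) (.inl ?_) (.inl ?_)).tendsto.comp
      (h1.prodMk_nhds ((continuous_neg.tendsto _).comp h2))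
    · simpa using hPinf
    · simp
  unfold eIntegral
  rw [hpos, hneg]
  refine tendsto_nhds_unique hlim ?_
  simp_rw [← hterm]
  refine tendsto_atTop_iInf fun m n hmn => EReal.coe_le_coe_iff.2 ?_
  refine integral_mono_ae (hint n) (hint m) ?_
  filter_upwards [hanti] with x hx using hx hmn

end ExtendedIntegral

section Components

variable {r : ℕ} {X : Type*} [mX : MeasurableSpace X] {T : BorelAction (FG r) X}
  {μ : Measure X} {τ : Measure (Measure X)}

lemma Generating.of_generateFrom {I : Type*} {a : X → I} {ν : Measure X} {C : Set (Set X)}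
    (hC : mX = MeasurableSpace.generateFrom C)
    (h : ∀ B ∈ C, ∃ B', MeasurableSet[T.partSA univ a] B' ∧ ν (B ∆ B') = 0) :
    T.Generating a ν := by
  intro B hB
  rw [hC] at hB
  induction B, hB using MeasurableSpace.generateFrom_induction with
  | hC t ht _ => exact h t ht
  | empty => exact ⟨∅, @MeasurableSet.empty _ (T.partSA univ a), by simp⟩
  | compl t _ ih =>
    obtain ⟨B', hB', h0⟩ := ih
    exact ⟨B'ᶜ, MeasurableSet.compl hB', by rwa [compl_symmDiff_compl]⟩
  | iUnion s _ ih =>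
    choose B' hB' h0 using ih
    refine ⟨⋃ n, B' n, MeasurableSet.iUnion hB', measure_mono_null ?_ (measure_iUnion_null h0)⟩
    rintro x (⟨hx, hx'⟩ | ⟨hx, hx'⟩) <;> simp only [mem_iUnion, not_exists] at hx hx' ⊢ <;>
      obtain ⟨n, hn⟩ := hx
    · exact ⟨n, .inl ⟨hn, hx' n⟩⟩
    · exact ⟨n, .inr ⟨hn, hx' n⟩⟩

lemma Decomposes.ae_generating [MeasurableSpace.CountablyGenerated X] (h : Decomposes T μ τ)
    {I : Type*} {a : X → I} (hgen : T.Generating a μ) : ∀ᵐ ν ∂τ, T.Generating a ν := by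
  obtain ⟨C, hCc, hC, -⟩ := exists_countable_piSystem X
  have hCm : ∀ B ∈ C, MeasurableSet B := fun B hB => by
    rw [hC]
    exact MeasurableSpace.measurableSet_generateFrom hB
  have : ∀ᵐ ν ∂τ, ∀ B ∈ C, ∃ B', MeasurableSet[T.partSA univ a] B' ∧ ν (B ∆ B') = 0 := by
    refine (ae_ball_iff hCc).2 fun B hB => ?_
    obtain ⟨B', hB', h0⟩ := hgen B (hCm B hB)
    filter_upwards [h.ae_ae (measure_eq_zero_iff_ae_notMem.1 h0)] with ν hν
    exact ⟨B', hB', measure_eq_zero_iff_ae_notMem.2 hν⟩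
  filter_upwards [this] with ν hν using Generating.of_generateFrom hC hν

variable [IsProbabilityMeasure μ] [IsProbabilityMeasure τ] {I : Type*} [Countable I]
  [MeasurableSpace I] [MeasurableSingletonClass I] {a : X → I}

lemma Decomposes.ae_Hpart_lt_top (h : Decomposes T μ τ) {c : X → I} (hc : Measurable c)
    (hfin : Hpart μ c < ⊤) : ∀ᵐ ν ∂τ, Hpart ν c < ⊤ :=
  ae_lt_top (measurable_Hpart hc) ((compEnt_le_Hpart h hc).trans_lt hfin).ne

omit [IsProbabilityMeasure μ] [IsProbabilityMeasure τ] in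
lemma measurable_FF (T : BorelAction (FG r) X) {b : X → I} (hb : Measurable b) :
    Measurable fun ν : Measure X => FF ν T b := by
  unfold FF
  exact ((measurable_Hpart hb).ennreal_toReal.const_mul _).add
    (Finset.measurable_sum _ fun i _ =>
      (measurable_Hpart ((measurable_tr hb (FreeGroup.of i)).prodMk hb)).ennreal_toReal)

section

variable (h : Decomposes T μ τ) (hT : T.Preserves μ) (ha : Measurable a) (hent : ent μ a < ⊤)
include h hT ha hent

omit hT in
lemma ae_antitone_FF : ∀ᵐ ν ∂τ, Antitone fun n => FF ν T (T.joinF (ball r n) a) := by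
  have hfin : Hpart μ a < ⊤ := by rwa [Hpart_eq_ent μ ha]
  filter_upwards [h.inv, h.ae_Hpart_lt_top ha hfin] with ν hν hlt
  have := hν.1
  exact FF_joinF_ball_antitone hν.2 ha (by rwa [← Hpart_eq_ent ν ha])

lemma integrable_joinEnt {F : Set (FG r)} (hF : F.Finite) :
    Integrable (fun ν => joinEnt ν T a F) τ ∧ ∫ ν, joinEnt ν T a F ∂τ = compJoinEnt τ T a F := by
  have := hF.to_subtype
  have hm : AEMeasurable (fun ν => ent ν (T.joinF F a)) τ := by
    refine (measurable_Hpart (measurable_joinF (T := T) ha F)).aemeasurable.congr ?_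
    filter_upwards [h.inv] with ν hν
    have := hν.1
    exact Hpart_eq_ent ν (measurable_joinF ha F)
  have hfin := (compEnt_joinF_lt_top h hT ha hent hF).ne
  exact ⟨integrable_toReal_of_lintegral_ne_top hm hfin,
    integral_toReal hm (ae_lt_top' hm hfin)⟩

lemma integrable_FF (n : ℕ) :
    Integrable (fun ν => FF ν T (T.joinF (ball r n) a)) τ ∧
      ∫ ν, FF ν T (T.joinF (ball r n) a) ∂τ = compFF τ T a (ball r n) := by
  have hball := toFinite (ball r n)
  have h0 := integrable_joinEnt h hT ha hent hball
  have h1 := fun i : Fin r => integrable_joinEnt h hT ha hent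
    (hball.union (hball.smul_set (a := FreeGroup.of i)))
  have hsum := integrable_finsetSum Finset.univ fun i (_ : i ∈ Finset.univ) => (h1 i).1
  have hae : (fun ν => FF ν T (T.joinF (ball r n) a)) =ᵐ[τ] fun ν =>
      (1 - 2 * (r : ℝ)) * joinEnt ν T a (ball r n)
        + ∑ i : Fin r, joinEnt ν T a (ball r n ∪ FreeGroup.of i • ball r n) := by
    filter_upwards [h.inv] with ν hν
    have := hν.1
    exact FF_joinF ha
  refine ⟨((h0.1.const_mul _).add hsum).congr hae.symm, ?_⟩
  rw [integral_congr_ae hae, integral_add (h0.1.const_mul _) hsum, integral_const_mul,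
    integral_finsetSum _ fun i _ => (h1 i).1, h0.2, compFF]
  simp_rw [fun i => (h1 i).2]

end

end Components

section Conclusion

variable {r : ℕ} {X : Type*} [mX : MeasurableSpace X] {T : BorelAction (FG r) X}
  {μ : Measure X} [IsProbabilityMeasure μ] {τ : Measure (Measure X)} [IsProbabilityMeasure τ]
  {a : X → ℕ}

lemma exists_lt_mul_Hpart {M : Type*} [MeasurableSpace M] {τ : Measure M}
    [IsProbabilityMeasure τ] {r : ℕ} (hr : 1 ≤ r) {b : ℝ}
    (hb : (b : EReal) < ((((r : ℝ≥0∞) - 1) * measEnt τ : ℝ≥0∞) : EReal)) :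
    ∃ (n : ℕ) (q : M → Fin n), Measurable q ∧ b < ((r : ℝ) - 1) * (Hpart τ q).toReal := by
  have hr' : (1 : ℝ) ≤ r := by exact_mod_cast hr
  have hrr : ((r : ℝ≥0∞) - 1).toReal = (r : ℝ) - 1 := by
    rw [ENNReal.toReal_sub_of_le (by exact_mod_cast hr) (by simp)]
    simp
  rcases lt_or_ge b 0 with hneg | hpos
  · exact ⟨1, fun _ => 0, measurable_const, hneg.trans_le
      (mul_nonneg (by linarith) ENNReal.toReal_nonneg)⟩
  have hb' : ENNReal.ofReal b < ((r : ℝ≥0∞) - 1) * measEnt τ := by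
    rw [← EReal.coe_ennreal_lt_coe_ennreal_iff, EReal.coe_ennreal_ofReal, max_eq_left hpos]
    exact hb
  have hr0 : (r : ℝ≥0∞) - 1 ≠ 0 := fun h0 => by simp [h0] at hb'
  have hrtop : (r : ℝ≥0∞) - 1 ≠ ⊤ := by simp
  rw [mul_comm, ← ENNReal.div_lt_iff (.inl hr0) (.inl hrtop)] at hb'
  obtain ⟨n, q, hq, hlt⟩ := exists_lt_Hpart_of_lt_measEnt hb'
  refine ⟨n, q, hq, ?_⟩
  have hfin : Hpart τ q ≠ ⊤ := by
    rw [Hpart_eq_ent τ hq]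
    exact (ent_lt_top_of_finite τ hq).ne
  rw [ENNReal.div_lt_iff (.inl hr0) (.inl hrtop), mul_comm,
    ENNReal.ofReal_lt_iff_lt_toReal hpos (ENNReal.mul_ne_top hrtop hfin), ENNReal.toReal_mul,
    hrr] at hlt
  exact hlt

variable (hr : 1 ≤ r) (h : Decomposes T μ τ) (hT : T.Preserves μ) (ha : Measurable a)
  (hent : ent μ a < ⊤)
include hr h hT ha hent

lemma fInv_le (hgen : T.Generating a μ) (n : ℕ) :
    fInv μ T a ≤ (compFF τ T a (ball r n) : EReal)
      - ((((r : ℝ≥0∞) - 1) * measEnt τ : ℝ≥0∞) : EReal) := by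
  by_contra! hlt
  obtain ⟨z, hz, hz'⟩ := EReal.lt_iff_exists_real_btwn.1 hlt
  rw [EReal.sub_lt_iff (.inl (EReal.coe_ennreal_ne_bot _)) (.inr (by simp))] at hz
  obtain ⟨N, q₀, hq₀, hq₀lt⟩ := exists_lt_mul_Hpart (τ := τ) hr
    (b := compFF τ T a (ball r n) - z) (by
      rw [EReal.coe_sub, EReal.sub_lt_iff (by simp) (by simp), add_comm]
      exact hz)
  obtain ⟨m, hm⟩ := exists_FF_le h hT ha hent hr hgen n hq₀ (sub_pos.2 hq₀lt)
  have : (z : EReal) < fSeq μ T a m := hz'.trans_le (iInf_le _ m)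
  rw [EReal.coe_lt_coe_iff] at this
  have hm' : fSeq μ T a m ≤ _ := hm
  linarith

lemma iInf_compFF_le_fInv :
    (⨅ n, (compFF τ T a (ball r n) : EReal)) - ((((r : ℝ≥0∞) - 1) * measEnt τ : ℝ≥0∞) : EReal)
      ≤ fInv μ T a := by
  by_cases htop : ((r : ℝ≥0∞) - 1) * measEnt τ = ⊤
  · simp [htop]
  have hrr : ((r : ℝ≥0∞) - 1).toReal = (r : ℝ) - 1 := by
    rw [ENNReal.toReal_sub_of_le (by exact_mod_cast hr) (by simp)]
    simp
  refine le_iInf fun n => ?_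
  rw [EReal.sub_le_iff_le_add (by simp) (by simp)]
  refine (iInf_le _ n).trans ?_
  rw [← EReal.coe_ennreal_toReal htop, ← EReal.coe_add, EReal.coe_le_coe_iff, ENNReal.toReal_mul,
    hrr]
  refine compFF_le_FF h hT ha hent hr (fun hlt hτ => htop ?_) n
  rw [hτ, ENNReal.mul_top]
  exact (tsub_pos_of_lt (by exact_mod_cast hlt)).ne'

lemma fInv_eq_iInf_sub (hgen : T.Generating a μ) :
    fInv μ T a = (⨅ n, (compFF τ T a (ball r n) : EReal))
      - ((((r : ℝ≥0∞) - 1) * measEnt τ : ℝ≥0∞) : EReal) := by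
  refine le_antisymm ?_ (iInf_compFF_le_fInv hr h hT ha hent)
  have hle := fInv_le hr h hT ha hent hgen
  by_cases htop : ((r : ℝ≥0∞) - 1) * measEnt τ = ⊤
  · simpa [htop] using hle 0
  have htop' : ((((r : ℝ≥0∞) - 1) * measEnt τ : ℝ≥0∞) : EReal) ≠ ⊤ :=
    mt EReal.coe_ennreal_eq_top_iff.1 htop
  rw [EReal.le_sub_iff_add_le (.inl (EReal.coe_ennreal_ne_bot _)) (.inl htop')]
  refine le_iInf fun n => ?_
  rw [← EReal.le_sub_iff_add_le (.inl (EReal.coe_ennreal_ne_bot _)) (.inl htop')]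
  exact hle n

omit hr in
lemma eIntegral_fInv :
    eIntegral τ (fun ν => fInv ν T a) = ⨅ n, (compFF τ T a (ball r n) : EReal) := by
  unfold fInv fSeq
  rw [eIntegral_iInf (fun n => measurable_FF T (measurable_joinF ha (ball r n)))
    (fun n => (integrable_FF h hT ha hent n).1) (ae_antitone_FF h ha hent)]
  exact iInf_congr fun n => congrArg _ (integrable_FF h hT ha hent n).2

end Conclusion

/-- The ergodic decomposition formula for f-invariant entropy:
`f_G(X, μ) = ∫ f_G(X, ν) dτ − (r − 1)·H(τ)`. -/
theorem statement3 {r : ℕ} (hr : 1 ≤ r) {X : Type*}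
    [mX : MeasurableSpace X] [StandardBorelSpace X]
    (μ : Measure X) [IsProbabilityMeasure μ]
    (T : BorelAction (FG r) X) (hT : T.Preserves μ)
    (a : X → ℕ) (ha : Measurable a) (hgen : T.Generating a μ) (hent : Hpart μ a < ⊤)
    (τ : Measure (Measure X)) [IsProbabilityMeasure τ]
    (hconc : τ (InvProb T) = 1)
    (hergm : τ {ν | T.IsErgodic ν} = 1)
    (hdec : ∀ B : Set X, MeasurableSet B → μ B = ∫⁻ ν, ν B ∂τ) :
    (∀ᵐ ν ∂τ, T.Generating a ν ∧ Hpart ν a < ⊤) ∧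
      fInv μ T a = eIntegral τ (fun ν => fInv ν T a)
        - ((((r : ℝ≥0∞) - 1) * measEnt τ : ℝ≥0∞) : EReal) := by
  have h : Decomposes T μ τ := decomposes_of_ergodic hr hconc hergm hdec
  have hent' : ent μ a < ⊤ := by rwa [← Hpart_eq_ent μ ha]
  refine ⟨(h.ae_generating hgen).and (h.ae_Hpart_lt_top ha hent), ?_⟩
  rw [eIntegral_fInv h hT ha hent']
  exact fInv_eq_iInf_sub hr h hT ha hent' hgen

end FPaper
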